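/- arXiv:2209.13339 — 9 statements merged into one kernel-verified Lean document; each statement's English description precedes it below -/
import Mathlib

section
/- Let S be an 𝔽_q-subspace of 𝔽_{q^n} with dim_{𝔽_q}(S) = n−1, and let γ ∈ 𝔽_{q^n}^* be such that 𝔽_q(γ) = 𝔽_{q^n} (equivalently, 1, γ, …, γ^{n−1} are 𝔽_q-linearly independent). Then there exists c ∈ 𝔽_{q^n}^* such that S = c·⟨1, γ, …, γ^{n−2}⟩_{𝔽_q}, the image under multiplication by c of the 𝔽_q-span of 1, γ, …, γ^{n−2}. -/
open scoped Pointwise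

/-- Proposition `lemm:formhyperplanes`.
Every `(n-1)`-dimensional `𝔽_q`-subspace `S` of `𝔽_{q^n}` is of the form
`c • ⟨1, γ, …, γ^{n-2}⟩_{𝔽_q}` for any generator `γ` of the extension. -/
theorem stmt_0 (q n : ℕ) (K L : Type*) [Field K] [Field L] [Algebra K L]
    [Fintype K] [Fintype L]
    (hq : Fintype.card K = q) (hn : Module.finrank K L = n)
    (S : Submodule K L) (hS : Module.finrank K ↥S = n - 1)
    (γ : L) (hγ0 : γ ≠ 0)
    (hγ : IntermediateField.adjoin K {γ} = ⊤) :
    ∃ c : L, c ≠ 0 ∧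
      S = c • Submodule.span K (Set.range fun i : Fin (n - 1) => γ ^ (i : ℕ)) := by
  have hn1 : 0 < n := hn ▸ Module.finrank_pos
  have hS_lt : S < ⊤ := Submodule.lt_top_of_finrank_lt_finrank (by omega)
  obtain ⟨f, hf, hSf⟩ := S.exists_le_ker_of_lt_top hS_lt
  have hSker : S = LinearMap.ker f := by
    refine Submodule.eq_of_le_of_finrank_le hSf ?_
    have h : Module.finrank K (LinearMap.ker f) < Module.finrank K L := by
      refine Submodule.finrank_lt fun h => hf ?_
      exact LinearMap.ker_eq_top.mp h
    omega
  obtain ⟨c, hc, hc0⟩ := (Submodule.ne_bot_iff _).mp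
    (LinearMap.ker_ne_bot_of_finrank_lt
      (f := LinearMap.pi fun i : Fin (n - 1) => f ∘ₗ LinearMap.mulRight K (γ ^ (i : ℕ)))
      (by simp only [Module.finrank_fin_fun]; omega))
  refine ⟨c, hc0, (Submodule.eq_of_le_of_finrank_le ?_ ?_).symm⟩
  · rw [Submodule.smul_span, Submodule.span_le]
    rintro _ ⟨_, ⟨i, rfl⟩, rfl⟩
    rw [hSker]
    exact congrFun hc i
  · have hdeg : (minpoly K γ).natDegree = n := by
      rw [← IntermediateField.adjoin.finrank (Algebra.IsIntegral.isIntegral γ), hγ,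
        IntermediateField.finrank_top', hn]
    have hind : LinearIndependent K fun i : Fin (n - 1) => c • γ ^ (i : ℕ) := by
      have h := (linearIndependent_pow (K := K) γ).comp
        (Fin.castLE (show n - 1 ≤ (minpoly K γ).natDegree by omega))
        (Fin.castLE_injective _)
      exact h.map' (LinearMap.mulLeft K c)
        (LinearMap.ker_eq_bot.mpr (mul_right_injective₀ hc0))
    rw [hS, Submodule.smul_span, ← Set.range_smul, finrank_span_eq_card hind, Fintype.card_fin]
end

section
/- Let S be an h-dimensional 𝔽_q-subspace of 𝔽_{q^n} with 1 ∈ S and h ≤ n−2. Let a, b ∈ 𝔽_{q^n} with a ∉ S and b ∉ 𝔽_q, and set U = (S × {0}) + ⟨(1,1)⟩_{𝔽_q} + ⟨(a,b)⟩_{𝔽_q} ⊆ 𝔽_{q^n}². Then dim_{𝔽_q}(U) = h+2 (so L_U = {⟨(s+α+βa, α+βb)⟩_{𝔽_{q^n}} : s ∈ S, α,β ∈ 𝔽_q, (s,α,β) ≠ (0,0,0)} is an 𝔽_q-linear set of rank h+2 in PG(1,q^n)), w_{L_U}(⟨(1,0)⟩_{𝔽_{q^n}}) = h, and w_{L_U}(⟨(0,1)⟩_{𝔽_{q^n}})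 = 1. -/
open scoped Pointwise

/-- The weight of the projective point `⟨v⟩_{𝔽_{q^n}}` with respect to the `𝔽_q`-subspace
`U ⊆ 𝔽_{q^n}²`, i.e. `dim_{𝔽_q}(U ∩ ⟨v⟩_{𝔽_{q^n}})`. -/
noncomputable def wt (K : Type*) {L : Type*} [Field K] [Field L] [Algebra K L]
    (U : Submodule K (L × L)) (v : L × L) : ℕ :=
  Module.finrank K ↥(U ⊓ (Submodule.span L {v}).restrictScalars K)

/-- Membership in `(S × {0}) + ⟨(1,1)⟩ + ⟨(a,b)⟩` in terms of coordinates. -/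
theorem mem_prod_bot_sup_span_sup_span {K L : Type*} [Field K] [Field L] [Algebra K L]
    (S : Submodule K L) (a b : L) (z : L × L) :
    z ∈ S.prod ⊥ ⊔ Submodule.span K {((1 : L), (1 : L))} ⊔ Submodule.span K {(a, b)} ↔
      ∃ s ∈ S, ∃ α β : K, z = (s + α • 1 + β • a, α • 1 + β • b) := by
  simp only [Submodule.mem_sup, Submodule.mem_span_singleton]
  constructor
  · rintro ⟨_, ⟨⟨s, t⟩, hs, _, ⟨α, rfl⟩, rfl⟩, _, ⟨β, rfl⟩, rfl⟩
    obtain ⟨hs, ht⟩ := Submodule.mem_prod.1 hs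
    have ht : t = 0 := by simpa using ht
    exact ⟨s, hs, α, β, by simp [ht]⟩
  · rintro ⟨s, hs, α, β, rfl⟩
    exact ⟨_, ⟨(s, 0), by simpa [Submodule.mem_prod] using hs, _, ⟨α, rfl⟩, rfl⟩,
      _, ⟨β, rfl⟩, by simp⟩

/-- `1` and `b` are linearly independent over `K` when `b ∉ K`. -/
theorem eq_zero_of_smul_one_add_smul_eq_zero {K L : Type*} [Field K] [Field L] [Algebra K L]
    {b : L} (hb : b ∉ Set.range (algebraMap K L)) {α β : K}
    (h : α • (1 : L) + β • b = 0) : α = 0 ∧ β = 0 := by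
  have hβ : β = 0 := by
    by_contra hβ
    refine hb ⟨-(β⁻¹ * α), ?_⟩
    have h' : β⁻¹ • (α • (1 : L) + β • b) = 0 := by rw [h, smul_zero]
    rw [smul_add, smul_smul, smul_smul, inv_mul_cancel₀ hβ, one_smul] at h'
    rw [Algebra.algebraMap_eq_smul_one, neg_smul]
    exact neg_eq_of_add_eq_zero_right h'
  subst hβ
  simpa using h

/-- The coordinate map `(s, α, β) ↦ (s + α + βa, α + βb)`. -/
def coordinateMap {K L : Type*} [Field K] [Field L] [Algebra K L]
    (S : Submodule K L) (a b : L) : (S × K × K) →ₗ[K] L × L where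
  toFun x := ((x.1 : L) + x.2.1 • 1 + x.2.2 • a, x.2.1 • 1 + x.2.2 • b)
  map_add' x y := by
    ext <;> simp only [Prod.fst_add, Prod.snd_add, Submodule.coe_add, add_smul] <;> abel
  map_smul' c x := by
    ext <;> simp [mul_smul]

/-- Proposition `prop:formclub`. -/
theorem stmt_1 (q n h : ℕ) (K L : Type*) [Field K] [Field L] [Algebra K L]
    [Fintype K] [Fintype L]
    (hq : Fintype.card K = q) (hn : Module.finrank K L = n)
    (S : Submodule K L) (hS : Module.finrank K ↥S = h) (h1S : (1 : L) ∈ S)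
    (hh : h ≤ n - 2)
    (a b : L) (ha : a ∉ S) (hb : b ∉ Set.range (algebraMap K L))
    (U : Submodule K (L × L))
    (hU : U = S.prod ⊥ ⊔ Submodule.span K {((1 : L), (1 : L))} ⊔
        Submodule.span K {(a, b)}) :
    Module.finrank K ↥U = h + 2 ∧
    wt K U ((1 : L), (0 : L)) = h ∧
    wt K U ((0 : L), (1 : L)) = 1 := by
  have hmem : ∀ z, z ∈ U ↔ ∃ s ∈ S, ∃ α β : K,
      z = (s + α • 1 + β • a, α • 1 + β • b) := by
    intro z
    rw [hU]
    exact mem_prod_bot_sup_span_sup_span S a b z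
  refine ⟨?_, ?_, ?_⟩
  · have hrange : U = LinearMap.range (coordinateMap S a b) := by
      ext z
      rw [hmem, LinearMap.mem_range]
      constructor
      · rintro ⟨s, hs, α, β, rfl⟩
        exact ⟨(⟨s, hs⟩, α, β), rfl⟩
      · rintro ⟨⟨s, α, β⟩, rfl⟩
        exact ⟨s, s.2, α, β, rfl⟩
    have hinj : Function.Injective (coordinateMap S a b) := by
      rw [← LinearMap.ker_eq_bot, LinearMap.ker_eq_bot']
      rintro ⟨s, α, β⟩ hx
      obtain ⟨h₁, h₂⟩ := Prod.ext_iff.1 hx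
      obtain ⟨rfl, rfl⟩ := eq_zero_of_smul_one_add_smul_eq_zero hb h₂
      simpa [coordinateMap] using h₁
    rw [hrange, LinearMap.finrank_range_of_inj hinj, Module.finrank_prod, Module.finrank_prod,
      Module.finrank_self, hS]
  · have hinter : U ⊓ (Submodule.span L {((1 : L), (0 : L))}).restrictScalars K =
        S.map (LinearMap.inl K L L) := by
      ext z
      rw [Submodule.mem_inf, hmem, Submodule.restrictScalars_mem,
        Submodule.mem_span_singleton, Submodule.mem_map]
      constructor
      · rintro ⟨⟨s, hs, α, β, rfl⟩, c, hc⟩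
        obtain ⟨-, h₂⟩ := Prod.ext_iff.1 hc
        obtain ⟨rfl, rfl⟩ := eq_zero_of_smul_one_add_smul_eq_zero hb
          (by simpa using h₂.symm)
        exact ⟨s, hs, by simp⟩
      · rintro ⟨s, hs, rfl⟩
        exact ⟨⟨s, hs, 0, 0, by simp⟩, s, by simp⟩
    rw [wt, hinter, (S.equivMapOfInjective _ LinearMap.inl_injective).symm.finrank_eq, hS]
  · have hinter : U ⊓ (Submodule.span L {((0 : L), (1 : L))}).restrictScalars K =
        Submodule.span K {((0 : L), (1 : L))} := by
      ext z
      rw [Submodule.mem_inf, hmem, Submodule.restrictScalars_mem,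
        Submodule.mem_span_singleton, Submodule.mem_span_singleton]
      constructor
      · rintro ⟨⟨s, hs, α, β, rfl⟩, c, hc⟩
        obtain ⟨h₁, -⟩ := Prod.ext_iff.1 hc
        have h₁ : s + α • (1 : L) + β • a = 0 := by simpa using h₁.symm
        have hβ : β = 0 := by
          by_contra hβ
          have hβa : β • a ∈ S := by
            rw [← neg_eq_of_add_eq_zero_right h₁]
            exact S.neg_mem (S.add_mem hs (S.smul_mem α h1S))
          exact ha ((S.smul_mem_iff hβ).1 hβa)
        subst hβ
        refine ⟨α, ?_⟩
        ext
        · simpa using h₁.symm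
        · simp
      · rintro ⟨α, rfl⟩
        exact ⟨⟨-(α • 1), S.neg_mem (S.smul_mem α h1S), α, 0, by simp⟩, α • 1, by simp⟩
    rw [wt, hinter, finrank_span_singleton (by simp)]
end

section
/- Let S be an h-dimensional 𝔽_q-subspace of 𝔽_{q^n} with 1 ∈ S and 3 ≤ h ≤ n−2, let a, b ∈ 𝔽_{q^n} with a ∉ S and b ∉ 𝔽_q, and set U = (S × {0}) ⊕ ⟨(1,1)⟩_{𝔽_q} ⊕ ⟨(a,b)⟩_{𝔽_q} ⊆ 𝔽_{q^n}². Then the set of points of weight 2 in L_U different from ⟨(1,0)⟩_{𝔽_{q^n}} is exactly {⟨(−s+a, b)⟩_{𝔽_{q^n}} : s ∈ S ∩ (a+bS)}, and the map s ↦ ⟨(−s+a,b)⟩_{𝔽_{q^n}} is a bijection from S ∩ (a+bS) onto this set, so the number of such points equals |S ∩ (a+bS)|. -/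
open scoped Pointwise

/-- Membership in `(S × 0) ⊕ ⟨(1,1)⟩ ⊕ ⟨(a,b)⟩` when `1 ∈ S`. -/
theorem mem_prod_bot_sup_span_iff {K L : Type*} [Field K] [Field L] [Algebra K L]
    {S : Submodule K L} (h1S : (1 : L) ∈ S) (a b x y : L) :
    (x, y) ∈ S.prod ⊥ ⊔ Submodule.span K {((1 : L), (1 : L))} ⊔ Submodule.span K {(a, b)} ↔
      ∃ α β : K, y = algebraMap K L α + algebraMap K L β * b ∧
        x - algebraMap K L β * a ∈ S := by
  simp only [Submodule.mem_sup, Submodule.mem_span_singleton]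
  constructor
  · rintro ⟨_, ⟨⟨s, t⟩, ⟨hs, ht⟩, _, ⟨α, rfl⟩, rfl⟩, _, ⟨β, rfl⟩, h⟩
    simp only [Prod.smul_mk, Prod.mk_add_mk, Prod.mk.injEq] at h
    rw [Algebra.smul_def, Algebra.smul_def, Algebra.smul_def, mul_one] at h
    obtain rfl : t = 0 := ht
    refine ⟨α, β, by rw [← h.2]; ring, ?_⟩
    rw [← h.1, add_sub_cancel_right]
    refine S.add_mem hs ?_
    simpa [Algebra.smul_def] using S.smul_mem α h1S
  · rintro ⟨α, β, rfl, hx⟩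
    refine ⟨_, ⟨(x - algebraMap K L β * a - algebraMap K L α, 0), ⟨S.sub_mem hx ?_, rfl⟩,
      _, ⟨α, rfl⟩, rfl⟩, _, ⟨β, rfl⟩, ?_⟩
    · simpa [Algebra.smul_def] using S.smul_mem α h1S
    · simp [Algebra.smul_def]

theorem finrank_span_one_pair {K L : Type*} [Field K] [Field L] [Algebra K L] {b : L}
    (hb : b ∉ Set.range (algebraMap K L)) :
    Module.finrank K (Submodule.span K {(1 : L), b}) = 2 := by
  have hli : LinearIndependent K ![(1 : L), b] := by
    refine (LinearIndependent.pair_iff' one_ne_zero).2 fun c hc => hb ⟨c, ?_⟩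
    rw [← hc, Algebra.smul_def, mul_one]
  rw [← Matrix.range_cons_cons_empty (1 : L) b ![], finrank_span_eq_card hli, Fintype.card_fin]

/-- The weight of `⟨(m,1)⟩` is the dimension of `{y | y • (m,1) ∈ U}`. -/
theorem wt_mk_one {K L : Type*} [Field K] [Field L] [Algebra K L]
    (U : Submodule K (L × L)) (m : L) :
    wt K U (m, 1) = Module.finrank K
      (U.comap ((LinearMap.toSpanSingleton L (L × L) (m, 1)).restrictScalars K)) := by
  set f := (LinearMap.toSpanSingleton L (L × L) (m, 1)).restrictScalars K with hf
  have hinj : Function.Injective f := fun x y hxy => by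
    simpa [hf] using congrArg Prod.snd hxy
  have hW : U ⊓ (Submodule.span L {((m, 1) : L × L)}).restrictScalars K = (U.comap f).map f := by
    ext v
    simp only [Submodule.mem_inf, Submodule.restrictScalars_mem, Submodule.mem_span_singleton,
      Submodule.mem_map, Submodule.mem_comap]
    constructor
    · rintro ⟨hv, y, rfl⟩
      exact ⟨y, hv, rfl⟩
    · rintro ⟨y, hy, rfl⟩
      exact ⟨hy, y, rfl⟩
  rw [wt, hW]
  exact (Submodule.equivMapOfInjective f hinj _).finrank_eq.symm

theorem wt_mk_one_eq_two_iff {K L : Type*} [Field K] [Field L] [Algebra K L]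
    {S : Submodule K L} (h1S : (1 : L) ∈ S) (a : L) {b : L}
    (hb : b ∉ Set.range (algebraMap K L)) (m : L) :
    wt K (S.prod ⊥ ⊔ Submodule.span K {((1 : L), (1 : L))} ⊔ Submodule.span K {(a, b)})
      (m, 1) = 2 ↔ m ∈ S ∧ m * b - a ∈ S := by
  rw [wt_mk_one]
  set T := Submodule.comap ((LinearMap.toSpanSingleton L (L × L) (m, 1)).restrictScalars K)
    (S.prod ⊥ ⊔ Submodule.span K {((1 : L), (1 : L))} ⊔ Submodule.span K {(a, b)})
  have hT (y : L) : y ∈ T ↔ ∃ α β : K, y = algebraMap K L α + algebraMap K L β * b ∧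
      y * m - algebraMap K L β * a ∈ S := by
    rw [← mem_prod_bot_sup_span_iff h1S]
    simp [T]
  have hcoord {α β γ δ : K} (h : algebraMap K L α + algebraMap K L β * b =
      algebraMap K L γ + algebraMap K L δ * b) : β = δ := by
    by_contra hne
    have hne' : algebraMap K L β - algebraMap K L δ ≠ 0 := by
      rwa [← map_sub, ne_eq, map_eq_zero, sub_eq_zero]
    refine hb ⟨(γ - α) / (β - δ), ?_⟩
    rw [map_div₀, map_sub, map_sub, div_eq_iff hne']
    linear_combination -h
  have hle : T ≤ Submodule.span K {(1 : L), b} := fun y hy => by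
    obtain ⟨α, β, rfl, -⟩ := (hT y).1 hy
    exact Submodule.mem_span_pair.2 ⟨α, β, by simp [Algebra.smul_def]⟩
  have hfin : FiniteDimensional K (Submodule.span K {(1 : L), b}) :=
    FiniteDimensional.span_of_finite K (Set.toFinite _)
  have hrank := finrank_span_one_pair hb
  constructor
  · intro h2
    have hTB := Submodule.eq_of_le_of_finrank_eq hle (h2.trans hrank.symm)
    constructor
    · obtain ⟨α, β, h1, hS⟩ := (hT 1).1 (hTB ▸ Submodule.subset_span (by simp))
      have hβ : β = 0 := (hcoord (α := 1) (β := 0) (by simpa using h1)).symm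
      simpa [hβ] using hS
    · obtain ⟨α, β, h1, hS⟩ := (hT b).1 (hTB ▸ Submodule.subset_span (by simp))
      have hβ : β = 1 := (hcoord (α := 0) (β := 1) (by simpa using h1)).symm
      simpa [hβ, mul_comm] using hS
  · rintro ⟨hm, hmb⟩
    have hTB : T = Submodule.span K {(1 : L), b} := by
      refine le_antisymm hle (Submodule.span_le.2 ?_)
      rintro y (rfl | rfl)
      · exact (hT 1).2 ⟨1, 0, by simp, by simpa using hm⟩
      · exact (hT y).2 ⟨0, 1, by simp, by simpa [mul_comm] using hmb⟩
    rw [hTB, hrank]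

theorem span_mk_eq_span_mk_iff {L : Type*} [Field L] {x y z w : L} (hy : y ≠ 0) (hw : w ≠ 0) :
    Submodule.span L {((x, y) : L × L)} = Submodule.span L {((z, w) : L × L)} ↔
      x * w = z * y := by
  rw [Submodule.span_singleton_eq_span_singleton]
  constructor
  · rintro ⟨u, hu⟩
    simp only [Prod.smul_mk, Prod.mk.injEq, Units.smul_def, smul_eq_mul] at hu
    rw [← hu.1, ← hu.2]
    ring
  · intro h
    refine ⟨Units.mk0 (w / y) (div_ne_zero hw hy), ?_⟩
    simp only [Prod.smul_mk, Prod.mk.injEq, Units.smul_def, smul_eq_mul, Units.val_mk0]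
    constructor <;> field_simp
    linear_combination h

theorem span_mk_ne_span_one_zero_iff {L : Type*} [Field L] {x y : L}
    (hv : ((x, y) : L × L) ≠ 0) :
    Submodule.span L {((x, y) : L × L)} ≠ Submodule.span L {((1 : L), (0 : L))} ↔ y ≠ 0 := by
  refine not_congr ?_
  rw [eq_comm, Submodule.span_singleton_eq_span_singleton]
  constructor
  · rintro ⟨u, hu⟩
    simpa using (congrArg Prod.snd hu).symm
  · rintro rfl
    have hx : x ≠ 0 := fun hx => hv (by simp [hx])
    exact ⟨Units.mk0 x hx, by simp [Units.smul_def]⟩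

/-- Theorem `teo:existenceclub`, first part.
Points of `PG(1,q^n)` are identified with the one-dimensional `𝔽_{q^n}`-subspaces
`span L {v}`, `v ≠ 0`, of `𝔽_{q^n}²`. -/
theorem stmt_2 (q n h : ℕ) (K L : Type*) [Field K] [Field L] [Algebra K L]
    [Fintype K] [Fintype L]
    (hq : Fintype.card K = q) (hn : Module.finrank K L = n)
    (S : Submodule K L) (hS : Module.finrank K ↥S = h) (h1S : (1 : L) ∈ S)
    (hh3 : 3 ≤ h) (hh : h ≤ n - 2)
    (a b : L) (ha : a ∉ S) (hb : b ∉ Set.range (algebraMap K L))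
    (U : Submodule K (L × L))
    (hU : U = S.prod ⊥ ⊔ Submodule.span K {((1 : L), (1 : L))} ⊔
        Submodule.span K {(a, b)}) :
    -- the points of weight 2 different from ⟨(1,0)⟩ are exactly the P_s, s ∈ S ∩ (a + bS)
    (∀ v : L × L, v ≠ 0 →
      ((wt K U v = 2 ∧
          Submodule.span L {v} ≠ Submodule.span L {((1 : L), (0 : L))}) ↔
        ∃ s ∈ S, (∃ s' ∈ S, s = a + b * s') ∧
          Submodule.span L {v} = Submodule.span L {(-s + a, b)})) ∧
    -- the correspondence s ↦ P_s is injective on S ∩ (a + bS)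
    (∀ s ∈ S, (∃ s' ∈ S, s = a + b * s') →
      ∀ s'' ∈ S, (∃ s' ∈ S, s'' = a + b * s') →
        Submodule.span L {((-s + a, b) : L × L)} =
          Submodule.span L {((-s'' + a, b) : L × L)} → s = s'') ∧
    -- hence the number of such points equals |S ∩ (a + bS)|
    Set.ncard {V : Submodule L (L × L) | ∃ v : L × L, v ≠ 0 ∧
        V = Submodule.span L {v} ∧ wt K U v = 2 ∧
        V ≠ Submodule.span L {((1 : L), (0 : L))}} =
      Set.ncard {x : L | x ∈ S ∧ ∃ s' ∈ S, x = a + b * s'} := by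
  subst hU
  have hb0 : b ≠ 0 := fun h0 => hb ⟨0, by simp [h0]⟩
  set U := S.prod ⊥ ⊔ Submodule.span K {((1 : L), (1 : L))} ⊔ Submodule.span K {(a, b)}
  have hpts : ∀ v : L × L, v ≠ 0 →
      ((wt K U v = 2 ∧
          Submodule.span L {v} ≠ Submodule.span L {((1 : L), (0 : L))}) ↔
        ∃ s ∈ S, (∃ s' ∈ S, s = a + b * s') ∧
          Submodule.span L {v} = Submodule.span L {(-s + a, b)}) := by
    rintro ⟨x, y⟩ hv
    rw [span_mk_ne_span_one_zero_iff hv]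
    have hwt (hy : y ≠ 0) : wt K U (x, y) = 2 ↔ x / y ∈ S ∧ x / y * b - a ∈ S := by
      rw [← wt_mk_one_eq_two_iff h1S a hb, wt, wt,
        (span_mk_eq_span_mk_iff hy one_ne_zero).2 (by field_simp : x * 1 = x / y * y)]
    constructor
    · rintro ⟨h2, hy⟩
      obtain ⟨hm, hmb⟩ := (hwt hy).1 h2
      refine ⟨a - x / y * b, by simpa using S.neg_mem hmb, ⟨-(x / y), S.neg_mem hm, by ring⟩, ?_⟩
      rw [span_mk_eq_span_mk_iff hy hb0]
      field_simp
      ring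
    · rintro ⟨s, hs, ⟨s', hs', rfl⟩, hspan⟩
      have hne : ((-(a + b * s') + a, b) : L × L) ≠ 0 := fun h => hb0 (congrArg Prod.snd h)
      have hy : y ≠ 0 := by
        rw [← span_mk_ne_span_one_zero_iff hv, hspan]
        exact (span_mk_ne_span_one_zero_iff hne).2 hb0
      have hxy : x / y = -s' := by
        rw [span_mk_eq_span_mk_iff hy hb0] at hspan
        rw [div_eq_iff hy]
        apply mul_right_cancel₀ hb0
        linear_combination hspan
      refine ⟨(hwt hy).2 ?_, hy⟩
      rw [hxy]
      refine ⟨S.neg_mem hs', ?_⟩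
      convert S.neg_mem hs using 1
      ring
  have hinj (s s'' : L) (h : Submodule.span L {((-s + a, b) : L × L)} =
      Submodule.span L {((-s'' + a, b) : L × L)}) : s = s'' := by
    rw [span_mk_eq_span_mk_iff hb0 hb0] at h
    simpa using mul_right_cancel₀ hb0 h
  refine ⟨hpts, fun s _ _ s'' _ _ h => hinj s s'' h, ?_⟩
  symm
  refine Set.ncard_congr (fun s _ => Submodule.span L {((-s + a, b) : L × L)}) ?_
    (fun s s'' _ _ h => hinj s s'' h) ?_
  · rintro s ⟨hs, hs'⟩
    have hne : ((-s + a, b) : L × L) ≠ 0 := fun h => hb0 (congrArg Prod.snd h)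
    exact ⟨_, hne, rfl, (hpts _ hne).2 ⟨s, hs, hs', rfl⟩⟩
  · rintro V ⟨v, hv, rfl, h⟩
    obtain ⟨s, hs, hs', hspan⟩ := (hpts v hv).1 h
    exact ⟨s, ⟨hs, hs'⟩, hspan.symm⟩
end

section
/- Let S be an h-dimensional 𝔽_q-subspace of 𝔽_{q^n} with 1 ∈ S and 3 ≤ h ≤ n−2, let a, b ∈ 𝔽_{q^n} with a ∉ S and b ∉ 𝔽_q, and set U = (S × {0}) ⊕ ⟨(1,1)⟩_{𝔽_q} ⊕ ⟨(a,b)⟩_{𝔽_q} ⊆ 𝔽_{q^n}². If a ∈ S + bS, then the number of points of weight 2 in L_U is q^j, where j = dim_{𝔽_q}(S ∩ bS) = 2h − dim_{𝔽_q}(S + bS), and |L_U| = q^{h+1} + q^h − q^{j+1} + 1. -/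
open scoped Pointwise

section Counting

variable {K L : Type*} [Field K] [Field L] [Algebra K L]

theorem mem_prod_bot_sup_span_sup_span_iff (S : Submodule K L) (h1S : (1 : L) ∈ S) (a b : L)
    (v : L × L) :
    v ∈ S.prod ⊥ ⊔ Submodule.span K {((1 : L), (1 : L))} ⊔ Submodule.span K {(a, b)} ↔
      ∃ x y : K, v.1 - y • a ∈ S ∧ v.2 = algebraMap K L x + y • b := by
  simp only [Submodule.mem_sup, Submodule.mem_span_singleton]
  constructor
  · rintro ⟨_, ⟨⟨s, t⟩, hs, _, ⟨x, rfl⟩, rfl⟩, _, ⟨y, rfl⟩, rfl⟩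
    rw [Submodule.mem_prod, Submodule.mem_bot] at hs
    obtain ⟨hs, rfl : t = 0⟩ := hs
    refine ⟨x, y, ?_, ?_⟩
    · simpa using S.add_mem hs (S.smul_mem x h1S)
    · simp [Algebra.algebraMap_eq_smul_one]
  · rintro ⟨x, y, hs, ht⟩
    refine ⟨_, ⟨(v.1 - y • a - x • 1, 0), ?_, _, ⟨x, rfl⟩, rfl⟩, _, ⟨y, rfl⟩, ?_⟩
    · exact ⟨S.sub_mem hs (S.smul_mem x h1S), rfl⟩
    · ext
      · simp
      · simp [ht, Algebra.algebraMap_eq_smul_one]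

theorem algebraMap_add_smul_eq_zero {b : L} (hb : b ∉ Set.range (algebraMap K L)) {x y : K}
    (h : algebraMap K L x + y • b = 0) : x = 0 ∧ y = 0 := by
  have hy : y = 0 := by
    by_contra hy
    refine hb ⟨-(y⁻¹ * x), ?_⟩
    have hy' : algebraMap K L y ≠ 0 := by simpa using hy
    rw [Algebra.smul_def] at h
    rw [map_neg, map_mul, map_inv₀]
    field_simp
    linear_combination -h
  subst hy
  simpa using h

theorem span_prodMk_one_injective :
    Function.Injective fun m : L ↦ Submodule.span L {(m, (1 : L))} := by
  intro m m' h
  have hm : (m, (1 : L)) ∈ Submodule.span L {(m', (1 : L))} := by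
    have h' : Submodule.span L {(m, (1 : L))} = Submodule.span L {(m', (1 : L))} := h
    exact h' ▸ Submodule.mem_span_singleton_self _
  obtain ⟨c, hc⟩ := Submodule.mem_span_singleton.1 hm
  simp only [Prod.smul_mk, smul_eq_mul, mul_one, Prod.mk.injEq] at hc
  rw [← hc.1, hc.2, one_mul]

theorem span_singleton_eq_of_snd_eq_zero {v : L × L} (hv : v ≠ 0) (h : v.2 = 0) :
    Submodule.span L {v} = Submodule.span L {((1 : L), (0 : L))} := by
  have h1 : v.1 ≠ 0 := fun h1 ↦ hv (Prod.ext h1 h)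
  rw [← Submodule.span_singleton_smul_eq (IsUnit.mk0 _ h1) ((1 : L), (0 : L))]
  congr 2
  ext <;> simp [h]

theorem span_singleton_eq_of_snd_ne_zero {v : L × L} (h : v.2 ≠ 0) :
    Submodule.span L {v} = Submodule.span L {(v.1 / v.2, (1 : L))} := by
  rw [← Submodule.span_singleton_smul_eq (IsUnit.mk0 _ h) (v.1 / v.2, (1 : L))]
  congr 2
  ext <;> simp [mul_div_cancel₀ _ h]

section Weight

variable {S : Submodule K L} {a b : L} {U : Submodule K (L × L)}

theorem wt_one_zero (hb : b ∉ Set.range (algebraMap K L))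
    (hU : ∀ v, v ∈ U ↔ ∃ x y : K, v.1 - y • a ∈ S ∧ v.2 = algebraMap K L x + y • b) :
    wt K U (1, 0) = Module.finrank K S := by
  have h : U ⊓ (Submodule.span L {((1 : L), (0 : L))}).restrictScalars K =
      S.map (LinearMap.inl K L L) := by
    ext v
    simp only [Submodule.mem_inf, Submodule.restrictScalars_mem, Submodule.mem_span_singleton,
      Submodule.mem_map, hU]
    constructor
    · rintro ⟨⟨x, y, hs, ht⟩, c, rfl⟩
      simp only [Prod.smul_mk, smul_eq_mul, mul_one, mul_zero] at hs ht
      obtain ⟨rfl, rfl⟩ := algebraMap_add_smul_eq_zero hb ht.symm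
      exact ⟨c, by simpa using hs, by simp⟩
    · rintro ⟨s, hs, rfl⟩
      exact ⟨⟨0, 0, by simpa using hs, by simp⟩, s, by simp⟩
  rw [wt, h]
  exact (Submodule.equivMapOfInjective _ LinearMap.inl_injective S).finrank_eq.symm

theorem wt_prodMk_one_eq_two_iff [FiniteDimensional K L]
    (hb : b ∉ Set.range (algebraMap K L))
    (hU : ∀ v, v ∈ U ↔ ∃ x y : K, v.1 - y • a ∈ S ∧ v.2 = algebraMap K L x + y • b) (m : L) :
    wt K U (m, 1) = 2 ↔ m ∈ S ∧ m * b - a ∈ S := by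
  let E : K × K →ₗ[K] L × L :=
    (LinearMap.toSpanSingleton K (L × L) (m, 1)).coprod
      (LinearMap.toSpanSingleton K (L × L) (m * b, b))
  have hE (x y : K) : E (x, y) = (x • m + y • (m * b), algebraMap K L x + y • b) := by
    simp [E, Algebra.algebraMap_eq_smul_one]
  have hEinj : Function.Injective E := by
    rw [← LinearMap.ker_eq_bot, LinearMap.ker_eq_bot']
    rintro ⟨x, y⟩ h
    rw [hE] at h
    obtain ⟨rfl, rfl⟩ := algebraMap_add_smul_eq_zero hb (congrArg Prod.snd h)
    rfl
  have hErank : Module.finrank K (LinearMap.range E) = 2 := by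
    rw [LinearMap.finrank_range_of_inj hEinj]
    simp
  have hle : U ⊓ (Submodule.span L {(m, (1 : L))}).restrictScalars K ≤ LinearMap.range E := by
    rintro v ⟨hv, hv'⟩
    obtain ⟨x, y, -, ht⟩ := (hU v).1 hv
    obtain ⟨c, rfl⟩ := Submodule.mem_span_singleton.1 hv'
    simp only [Prod.smul_mk, smul_eq_mul, mul_one] at ht
    refine ⟨(x, y), ?_⟩
    rw [hE, ht, Prod.smul_mk]
    ext
    · simp only [Algebra.smul_def, Algebra.algebraMap_self, RingHom.id_apply]
      ring
    · simp
  constructor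
  · intro h
    have heq := Submodule.eq_of_le_of_finrank_eq hle (h.trans hErank.symm)
    have key (x y : K) : E (x, y) ∈ U := (heq.ge ⟨(x, y), rfl⟩ : _ ∈ U ⊓ _).1
    constructor
    · obtain ⟨x, y, hs, ht⟩ := (hU _).1 (key 1 0)
      rw [hE] at hs ht
      have h0 : algebraMap K L (x - 1) + y • b = 0 := by
        simp only [map_one, zero_smul, add_zero] at ht
        rw [map_sub, map_one]
        linear_combination -ht
      obtain ⟨-, rfl⟩ := algebraMap_add_smul_eq_zero hb h0
      simpa using hs
    · obtain ⟨x, y, hs, ht⟩ := (hU _).1 (key 0 1)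
      rw [hE] at hs ht
      have h0 : algebraMap K L x + (y - 1) • b = 0 := by
        simp only [map_zero, one_smul, zero_add] at ht
        rw [sub_smul, one_smul]
        linear_combination -ht
      obtain ⟨-, hy⟩ := algebraMap_add_smul_eq_zero hb h0
      obtain rfl : y = 1 := sub_eq_zero.1 hy
      simpa using hs
  · rintro ⟨hm, hmb⟩
    rw [wt, hle.antisymm, hErank]
    rintro _ ⟨⟨x, y⟩, rfl⟩
    rw [hE]
    refine ⟨(hU _).2 ⟨x, y, ?_, rfl⟩, Submodule.mem_span_singleton.2
      ⟨algebraMap K L x + y • b, ?_⟩⟩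
    · have := S.add_mem (S.smul_mem x hm) (S.smul_mem y hmb)
      rwa [smul_sub, ← add_sub_assoc] at this
    · rw [Prod.smul_mk]
      ext
      · simp only [Algebra.smul_def, Algebra.algebraMap_self, RingHom.id_apply]
        ring
      · simp

end Weight

/-- The scalars `m` such that `⟨(m, 1)⟩` contains a vector `(s + y • a, x + y • b)`, `s ∈ S`, with
`(x : y)` a prescribed point of the projective line over `K`; that line is `Option K`, with
`none` for `(1 : 0)` and `some x` for `(x : 1)`. -/
def slice (S : Submodule K L) (a b : L) : Option K → Set L
  | none => S
  | some x => {m | m * (algebraMap K L x + b) - a ∈ S}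

variable {S : Submodule K L} {a b : L}

theorem mem_of_mem_slice_of_mem_slice {i i' : Option K} (hi : i ≠ i') {m : L}
    (h : m ∈ slice S a b i) (h' : m ∈ slice S a b i') : m ∈ S ∧ m * b - a ∈ S := by
  have none_some {x : K} (h : m ∈ S) (h' : m * (algebraMap K L x + b) - a ∈ S) :
      m * b - a ∈ S := by
    have := S.sub_mem h' (S.smul_mem x h)
    rw [Algebra.smul_def] at this
    convert this using 1
    ring
  match i, i' with
  | none, none => exact absurd rfl hi
  | none, some x => exact ⟨h, none_some h h'⟩
  | some x, none => exact ⟨h', none_some h' h⟩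
  | some x, some y =>
    have hxy : x - y ≠ 0 := fun e ↦ hi (congrArg some (sub_eq_zero.1 e))
    have hm : m ∈ S := by
      have := S.sub_mem h h'
      rw [← S.smul_mem_iff hxy, Algebra.smul_def, map_sub]
      convert this using 1
      ring
    exact ⟨hm, none_some hm h⟩

theorem mem_slice (i : Option K) {m : L} (h : m ∈ S ∧ m * b - a ∈ S) : m ∈ slice S a b i := by
  match i with
  | none => exact h.1
  | some x =>
    have := S.add_mem h.2 (S.smul_mem x h.1)
    rw [Algebra.smul_def] at this
    change _ ∈ S
    convert this using 1
    ring

theorem ncard_slice (hb : b ∉ Set.range (algebraMap K L)) (i : Option K) :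
    (slice S a b i).ncard = Nat.card S := by
  match i with
  | none => rfl
  | some x =>
    have hx : algebraMap K L x + b ≠ 0 := fun h ↦ by
      have := algebraMap_add_smul_eq_zero hb (x := x) (y := 1) (by simpa using h)
      exact one_ne_zero this.2
    have hinj : Function.Injective fun m : L ↦ m * (algebraMap K L x + b) - a :=
      fun m m' h ↦ mul_right_cancel₀ hx (sub_left_injective h)
    have hsurj : Function.Surjective fun m : L ↦ m * (algebraMap K L x + b) - a :=
      fun y ↦ ⟨(y + a) / (algebraMap K L x + b), by simp [div_mul_cancel₀ _ hx]⟩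
    exact Set.ncard_preimage_of_injective_subset_range hinj
      (by rw [hsurj.range_eq]; exact Set.subset_univ _)

theorem ncard_iUnion_slice [Fintype K] [Finite L] (hb : b ∉ Set.range (algebraMap K L)) :
    (⋃ i, slice S a b i).ncard = {m | m ∈ S ∧ m * b - a ∈ S}.ncard +
      (Fintype.card K + 1) * (Nat.card S - {m | m ∈ S ∧ m * b - a ∈ S}.ncard) := by
  set W : Set L := {m | m ∈ S ∧ m * b - a ∈ S} with hW
  have hsub (i : Option K) : W ⊆ slice S a b i := fun m hm ↦ mem_slice i hm
  have hunion : (⋃ i, slice S a b i) = W ∪ ⋃ i, (slice S a b i \ W) := by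
    rw [← Set.iUnion_sdiff, Set.union_sdiff_cancel]
    exact (hsub none).trans (Set.subset_iUnion _ _)
  have hdisj : Disjoint W (⋃ i, (slice S a b i \ W)) := by
    rw [← Set.iUnion_sdiff]
    exact Set.disjoint_sdiff_right
  rw [hunion, Set.ncard_union_eq hdisj (Set.toFinite _) (Set.toFinite _),
    Set.ncard_iUnion_of_finite (fun _ ↦ Set.toFinite _), finsum_eq_sum_of_fintype]
  · simp [Set.ncard_sdiff (hsub _), ncard_slice hb]
  · intro i i' hi
    rw [Function.onFun, Set.disjoint_left]
    exact fun m h h' ↦ h.2 (mem_of_mem_slice_of_mem_slice hi h.1 h'.1)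

theorem ncard_setOf_mem_and_mul_sub_mem (hb : b ≠ 0)
    (ha : ∃ s₁ ∈ S, ∃ s₂ ∈ S, a = s₁ + b * s₂) :
    {m | m ∈ S ∧ m * b - a ∈ S}.ncard = Nat.card ↥(S ⊓ b • S) := by
  obtain ⟨s₁, h₁, s₂, h₂, rfl⟩ := ha
  have hinj : Function.Injective fun m : L ↦ b * (m - s₂) :=
    fun m m' h ↦ sub_left_injective (mul_left_cancel₀ hb h)
  rw [← Set.ncard_image_of_injective _ hinj, ← Nat.card_coe_set_eq]
  congr 2
  ext y
  simp only [Set.mem_image, Set.mem_ofPred_eq]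
  constructor
  · rintro ⟨m, ⟨hm, hmb⟩, rfl⟩
    refine ⟨?_, Submodule.smul_mem_pointwise_smul _ b S (S.sub_mem hm h₂)⟩
    have := S.add_mem hmb h₁
    change _ ∈ S
    convert this using 1
    ring
  · rintro ⟨hy, hy'⟩
    obtain ⟨s, hs, rfl⟩ := (Submodule.mem_smul_pointwise_iff_exists _ b S).1 hy'
    refine ⟨s + s₂, ⟨S.add_mem hs h₂, ?_⟩, by simp⟩
    have := S.sub_mem hy h₁
    rw [smul_eq_mul] at this
    convert this using 1
    ring

theorem setOf_span_singleton_eq_insert {U : Submodule K (L × L)}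
    (hb : b ∉ Set.range (algebraMap K L)) (h1S : (1 : L) ∈ S)
    (hU : ∀ v, v ∈ U ↔ ∃ x y : K, v.1 - y • a ∈ S ∧ v.2 = algebraMap K L x + y • b) :
    {V : Submodule L (L × L) | ∃ v : L × L, v ≠ 0 ∧ v ∈ U ∧ V = Submodule.span L {v}} =
      insert (Submodule.span L {((1 : L), (0 : L))})
        ((fun m : L ↦ Submodule.span L {(m, (1 : L))}) '' ⋃ i : Option K, slice S a b i) := by
  ext V
  simp only [Set.mem_insert_iff, Set.mem_image, Set.mem_iUnion, Set.mem_ofPred_eq]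
  constructor
  · rintro ⟨v, hv, hvU, rfl⟩
    by_cases h2 : v.2 = 0
    · exact Or.inl (span_singleton_eq_of_snd_eq_zero hv h2)
    refine Or.inr ⟨v.1 / v.2, ?_, (span_singleton_eq_of_snd_ne_zero h2).symm⟩
    obtain ⟨x, y, hs, ht⟩ := (hU v).1 hvU
    by_cases hy : y = 0
    · subst hy
      refine ⟨none, ?_⟩
      simp only [zero_smul, sub_zero, add_zero] at hs ht
      have := S.smul_mem x⁻¹ hs
      rw [Algebra.smul_def, map_inv₀, ← ht] at this
      change _ ∈ S
      rwa [div_eq_inv_mul]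
    · refine ⟨some (y⁻¹ * x), ?_⟩
      have := S.smul_mem y⁻¹ hs
      rw [Algebra.smul_def, Algebra.smul_def, map_inv₀] at this
      have hy' : algebraMap K L y ≠ 0 := by simpa using hy
      have hx : algebraMap K L (y⁻¹ * x) + b = (algebraMap K L y)⁻¹ * v.2 := by
        rw [ht, Algebra.smul_def, map_mul, map_inv₀]
        field_simp
      change _ * (algebraMap K L (y⁻¹ * x) + b) - a ∈ S
      rw [hx]
      convert this using 1
      field_simp
  · rintro (rfl | ⟨m, ⟨i, hi⟩, rfl⟩)
    · exact ⟨(1, 0), by simp, (hU _).2 ⟨0, 0, by simpa using h1S, by simp⟩, rfl⟩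
    match i with
    | none =>
      have hm : m ∈ S := hi
      exact ⟨(m, 1), by simp, (hU _).2 ⟨1, 0, by simpa using hm, by simp⟩, rfl⟩
    | some x =>
      have hx : algebraMap K L x + b ≠ 0 := fun h ↦ by
        have := algebraMap_add_smul_eq_zero hb (x := x) (y := 1) (by simpa using h)
        exact one_ne_zero this.2
      have hm : m * (algebraMap K L x + b) - a ∈ S := hi
      refine ⟨(m * (algebraMap K L x + b), algebraMap K L x + b), ?_,
        (hU _).2 ⟨x, 1, by simpa using hm, by simp⟩, ?_⟩
      · exact fun h ↦ hx (congrArg Prod.snd h)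
      · rw [span_singleton_eq_of_snd_ne_zero
          (v := (m * (algebraMap K L x + b), algebraMap K L x + b)) hx, mul_div_cancel_right₀ _ hx]

theorem setOf_wt_eq_two_eq_image [FiniteDimensional K L] {U : Submodule K (L × L)}
    (hb : b ∉ Set.range (algebraMap K L)) (hS : Module.finrank K S ≠ 2)
    (hU : ∀ v, v ∈ U ↔ ∃ x y : K, v.1 - y • a ∈ S ∧ v.2 = algebraMap K L x + y • b) :
    {V : Submodule L (L × L) | ∃ v : L × L, v ≠ 0 ∧ V = Submodule.span L {v} ∧ wt K U v = 2} =
      (fun m : L ↦ Submodule.span L {(m, (1 : L))}) '' {m | m ∈ S ∧ m * b - a ∈ S} := by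
  ext V
  simp only [Set.mem_image, Set.mem_ofPred_eq]
  constructor
  · rintro ⟨v, hv, rfl, hw⟩
    by_cases h2 : v.2 = 0
    · rw [wt, span_singleton_eq_of_snd_eq_zero hv h2, ← wt, wt_one_zero hb hU] at hw
      exact absurd hw hS
    · have hspan := span_singleton_eq_of_snd_ne_zero h2
      rw [wt, hspan, ← wt, wt_prodMk_one_eq_two_iff hb hU] at hw
      exact ⟨_, hw, hspan.symm⟩
  · rintro ⟨m, hm, rfl⟩
    exact ⟨(m, 1), by simp, rfl, (wt_prodMk_one_eq_two_iff hb hU m).2 hm⟩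

theorem finrank_pointwise_smul (hb : b ≠ 0) (S : Submodule K L) :
    Module.finrank K ↥(b • S) = Module.finrank K S :=
  (Submodule.equivMapOfInjective (DistribSMul.toLinearMap K L b)
    (mul_right_injective₀ hb) S).finrank_eq.symm

end Counting

/-- Corollary `cor:cardcasenotclub`.
Points of `PG(1,q^n)` are identified with the one-dimensional `𝔽_{q^n}`-subspaces
`span L {v}`, `v ≠ 0`, of `𝔽_{q^n}²`; `L_U` is the set of points spanned by nonzero
vectors of `U`. -/
theorem stmt_4 (q n h j : ℕ) (K L : Type*) [Field K] [Field L] [Algebra K L]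
    [Fintype K] [Fintype L]
    (hq : Fintype.card K = q) (hn : Module.finrank K L = n)
    (S : Submodule K L) (hS : Module.finrank K ↥S = h) (h1S : (1 : L) ∈ S)
    (hh3 : 3 ≤ h) (hh : h ≤ n - 2)
    (a b : L) (ha : a ∉ S) (hb : b ∉ Set.range (algebraMap K L))
    (U : Submodule K (L × L))
    (hU : U = S.prod ⊥ ⊔ Submodule.span K {((1 : L), (1 : L))} ⊔
        Submodule.span K {(a, b)})
    (ha' : ∃ s₁ ∈ S, ∃ s₂ ∈ S, a = s₁ + b * s₂)
    (hj : j = Module.finrank K ↥(S ⊓ b • S)) :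
    j = 2 * h - Module.finrank K ↥(S ⊔ b • S) ∧
    Set.ncard {V : Submodule L (L × L) | ∃ v : L × L, v ≠ 0 ∧
        V = Submodule.span L {v} ∧ wt K U v = 2} = q ^ j ∧
    Set.ncard {V : Submodule L (L × L) | ∃ v : L × L, v ≠ 0 ∧ v ∈ U ∧
        V = Submodule.span L {v}} = q ^ (h + 1) + q ^ h - q ^ (j + 1) + 1 := by
  have hb0 : b ≠ 0 := fun h ↦ hb ⟨0, by simp [h]⟩
  have hmem (v : L × L) : v ∈ U ↔ ∃ x y : K, v.1 - y • a ∈ S ∧ v.2 = algebraMap K L x + y • b := by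
    rw [hU, mem_prod_bot_sup_span_sup_span_iff S h1S]
  have hdim := Submodule.finrank_sup_add_finrank_inf_eq S (b • S)
  rw [finrank_pointwise_smul hb0, hS, ← hj] at hdim
  have hcard (T : Submodule K L) : Nat.card T = q ^ Module.finrank K T := by
    rw [Module.natCard_eq_pow_finrank (K := K), Nat.card_eq_fintype_card, hq]
  have hW : {m | m ∈ S ∧ m * b - a ∈ S}.ncard = q ^ j := by
    rw [ncard_setOf_mem_and_mul_sub_mem hb0 ha', hcard, hj]
  refine ⟨by omega, ?_, ?_⟩
  · rw [setOf_wt_eq_two_eq_image hb (by omega) hmem,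
      Set.ncard_image_of_injective _ span_prodMk_one_injective, hW]
  · have hjh : j ≤ h := hj ▸ hS ▸ Submodule.finrank_mono inf_le_left
    have hq0 : 0 < q := hq ▸ Fintype.card_pos
    have hle : q ^ j ≤ q ^ h := Nat.pow_le_pow_right hq0 hjh
    have hnot : Submodule.span L {((1 : L), (0 : L))} ∉
        (fun m : L ↦ Submodule.span L {(m, (1 : L))}) '' ⋃ i : Option K, slice S a b i := by
      rintro ⟨m, -, hm⟩
      have hm' : (m, (1 : L)) ∈ Submodule.span L {((1 : L), (0 : L))} :=
        hm ▸ Submodule.mem_span_singleton_self _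
      obtain ⟨c, hc⟩ := Submodule.mem_span_singleton.1 hm'
      simp at hc
    rw [setOf_span_singleton_eq_insert hb h1S hmem, Set.ncard_insert_of_notMem hnot,
      Set.ncard_image_of_injective _ span_prodMk_one_injective, ncard_iUnion_slice hb, hW, hcard,
      hS, hq]
    obtain ⟨d, hd⟩ := Nat.exists_eq_add_of_le hle
    rw [pow_succ, pow_succ, hd, Nat.add_sub_cancel_left]
    congr 1
    symm
    apply Nat.sub_eq_of_eq_add
    ring
end

section
/- Let n = rt with t, r > 1, and for j = 1, 2 let f_j(x) = Σ_{i=0}^{t−1} f_{j,i} x^{q^i} with f_{j,i} ∈ 𝔽_{q^t} be scattered q-polynomials over 𝔽_{q^t}. Let a_1, a_2, b_1, b_2 ∈ 𝔽_{q^t} with b_1, b_2 ≠ 0, and let ω_1, ω_2 ∈ 𝔽_{q^n} be such that {1, ω_j, …, ω_j^{r−1}} is an 𝔽_{q^t}-basis of 𝔽_{q^n} for j = 1, 2. Set U_j = {(f_j(x_0) − a_j x_0, b_j x_0 + Σ_{i=1}^{r−1} x_i ω_j^i) : x_0, …, x_{r−1} ∈ 𝔽_{q^t}} ⊆ 𝔽_{q^n}².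 Then U_1 and U_2 are ΓL(2,q^n)-equivalent if and only if the 𝔽_q-subspaces Ū_{f_1} = {(f_1(x) − a_1 x, b_1 x) : x ∈ 𝔽_{q^t}} and Ū_{f_2} = {(f_2(x) − a_2 x, b_2 x) : x ∈ 𝔽_{q^t}} of 𝔽_{q^t}² are ΓL(2,q^t)-equivalent via a map φ satisfying φ(⟨(0,1)⟩_{𝔽_{q^t}}) = ⟨(0,1)⟩_{𝔽_{q^t}}. -/
open scoped Pointwise

/-- The semilinear bijections of `E²` with lower triangular matrix. -/
lemma exists_addEquiv_lowerTriangular {E : Type*} [Field E] (ρ : E ≃+* E) (α γ δ : E)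
    (hα : α ≠ 0) (hδ : δ ≠ 0) :
    ∃ φ : (E × E) ≃+ (E × E), ∀ p, φ p = (α * ρ p.1, γ * ρ p.1 + δ * ρ p.2) := by
  let g : (E × E) →+ (E × E) :=
    { toFun := fun p => (α * ρ p.1, γ * ρ p.1 + δ * ρ p.2)
      map_zero' := by simp
      map_add' := fun p p' => by ext <;> simp <;> ring }
  have hg : Function.Bijective g := by
    constructor
    · rw [injective_iff_map_eq_zero]
      rintro ⟨x, y⟩ h
      have h1 : α * ρ x = 0 := congrArg Prod.fst h
      have h2 : γ * ρ x + δ * ρ y = 0 := congrArg Prod.snd h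
      have hx : x = 0 := by simpa [hα] using h1
      subst hx
      have hy : y = 0 := by simpa [hδ] using h2
      rw [hy]; rfl
    · rintro ⟨u, v⟩
      refine ⟨(ρ.symm (α⁻¹ * u), ρ.symm (δ⁻¹ * (v - γ * (α⁻¹ * u)))), ?_⟩
      change (α * ρ _, γ * ρ _ + δ * ρ _) = _
      ext
      · simp [hα]
      · simp only [RingEquiv.apply_symm_apply]
        field_simp
        ring
  exact ⟨AddEquiv.ofBijective g hg, fun p => rfl⟩

lemma semilinear_apply {E : Type*} [Field E] (ρ : E ≃+* E) (φ : (E × E) ≃+ (E × E))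
    (h : ∀ (l : E) (v : E × E), φ (l • v) = ρ l • φ v) (x y : E) :
    φ (x, y) = (ρ x * (φ (1, 0)).1 + ρ y * (φ (0, 1)).1,
      ρ x * (φ (1, 0)).2 + ρ y * (φ (0, 1)).2) := by
  have : ((x, y) : E × E) = x • ((1, 0) : E × E) + y • ((0, 1) : E × E) := by simp
  rw [this, map_add, h, h]
  rfl

/-- An automorphism of a finite field restricts to every subfield. -/
lemma exists_ringEquiv_restrict {M L : Type*} [Field M] [Field L] [Algebra M L] [Finite M]
    [Finite L] (σ : L ≃+* L) :
    ∃ τ : M ≃+* M, ∀ m, σ (algebraMap M L m) = algebraMap M L (τ m) := by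
  obtain ⟨p, hp⟩ := CharP.exists M
  have : Fact p.Prime := ⟨CharP.char_is_prime M p⟩
  have : CharP L p := charP_of_injective_algebraMap (algebraMap M L).injective p
  let _ := ZMod.algebra M p
  let _ := ZMod.algebra L p
  let σ' : L ≃ₐ[ZMod p] L := AlgEquiv.ofRingEquiv (f := σ) fun x =>
    congrFun (congrArg DFunLike.coe (Subsingleton.elim
      ((σ : L →+* L).comp (algebraMap (ZMod p) L)) (algebraMap (ZMod p) L))) x
  have : IsScalarTower (ZMod p) M L := IsScalarTower.of_algebraMap_eq' (Subsingleton.elim _ _)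
  exact ⟨(σ'.restrictNormal M).toRingEquiv, fun m =>
    (AlgEquiv.restrictNormal_commutes σ' M m).symm⟩

/-- An automorphism of a finite field extends to every finite extension. -/
lemma exists_ringEquiv_extend {M L : Type*} [Field M] [Field L] [Algebra M L] [Finite M]
    [Finite L] (τ : M ≃+* M) :
    ∃ σ : L ≃+* L, ∀ m, σ (algebraMap M L m) = algebraMap M L (τ m) := by
  obtain ⟨p, hp⟩ := CharP.exists M
  have : Fact p.Prime := ⟨CharP.char_is_prime M p⟩
  have : CharP L p := charP_of_injective_algebraMap (algebraMap M L).injective p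
  let _ := ZMod.algebra M p
  let _ := ZMod.algebra L p
  let τ' : M ≃ₐ[ZMod p] M := AlgEquiv.ofRingEquiv (f := τ) fun x =>
    congrFun (congrArg DFunLike.coe (Subsingleton.elim
      ((τ : M →+* M).comp (algebraMap (ZMod p) M)) (algebraMap (ZMod p) M))) x
  have : IsScalarTower (ZMod p) M L := IsScalarTower.of_algebraMap_eq' (Subsingleton.elim _ _)
  exact ⟨(τ'.liftNormal L).toRingEquiv, fun m => AlgEquiv.liftNormal_commutes τ' L m⟩

/-- The projection of `L` onto `M` along the span of `ω, …, ω ^ (r - 1)`. -/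
lemma exists_constantCoeff {M L : Type*} [Field M] [Field L] [Algebra M L] (r : ℕ) (hr : 1 < r)
    (ω : L) (hli : LinearIndependent M (fun i : Fin r => ω ^ (i : ℕ)))
    (hsp : Submodule.span M (Set.range fun i : Fin r => ω ^ (i : ℕ)) = ⊤) :
    ∃ π : L →ₗ[M] M, π 1 = 1 ∧ (∃ w, w ≠ 0 ∧ π w = 0) ∧
      ∀ y m, π y = m ↔ ∃ x : Fin (r - 1) → M, y = algebraMap M L m +
        ∑ i : Fin (r - 1), algebraMap M L (x i) * ω ^ ((i : ℕ) + 1) := by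
  obtain ⟨s, rfl⟩ : ∃ s, r = s + 1 := ⟨r - 1, by omega⟩
  let B := Module.Basis.mk hli hsp.ge
  have hB : ∀ i, B i = ω ^ (i : ℕ) := fun i => Module.Basis.mk_apply hli hsp.ge i
  have hπ : ∀ i : Fin (s + 1), B.coord 0 (ω ^ (i : ℕ)) = if i = 0 then 1 else 0 := fun i => by
    rw [← hB, Module.Basis.coord_apply, Module.Basis.repr_self, Finsupp.single_apply]
  have h1 : B.coord 0 (1 : L) = 1 := by simpa using hπ 0
  have hsucc : ∀ i : Fin s, B.coord 0 (ω ^ ((i : ℕ) + 1)) = 0 := fun i => by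
    simpa using hπ i.succ
  refine ⟨B.coord 0, h1, ⟨ω ^ 1, ?_, hsucc ⟨0, by omega⟩⟩, fun y m => ⟨?_, ?_⟩⟩
  · have := B.ne_zero ⟨1, hr⟩
    rwa [hB] at this
  · rintro rfl
    refine ⟨fun i => B.repr y i.succ, ?_⟩
    conv_lhs => rw [← B.sum_repr y]
    rw [Fin.sum_univ_succ]
    simp [hB, Algebra.smul_def]
  · rintro ⟨x, rfl⟩
    simp only [Algebra.algebraMap_eq_smul_one, smul_mul_assoc, one_mul, map_add, map_sum,
      map_smul, h1]
    simp [hsucc]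

/-- Every linear functional on a finite extension is `y ↦ π (c * y)`, if `π ≠ 0`. -/
lemma exists_mul_functional {M L : Type*} [Field M] [Field L] [Algebra M L]
    [FiniteDimensional M L] (π θ : L →ₗ[M] M) (h1 : π 1 = 1) :
    ∃ c, ∀ y, π (c * y) = θ y := by
  let Φ : L →ₗ[M] Module.Dual M L := (LinearMap.mul M L).compr₂ π
  have hinj : Function.Injective Φ := by
    rw [injective_iff_map_eq_zero]
    intro c hc
    by_contra hne
    have : π (c * c⁻¹) = 0 := congrArg (fun g : Module.Dual M L => g c⁻¹) hc
    simp [hne, h1] at this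
  have hsurj : Function.Surjective Φ :=
    (LinearMap.injective_iff_surjective_of_finrank_eq_finrank
      (Subspace.dual_finrank_eq (K := M) (V := L)).symm).1 hinj
  obtain ⟨c, hc⟩ := hsurj θ
  exact ⟨c, fun y => congrArg (fun g : Module.Dual M L => g y) hc⟩

/-- The subspace of `L²` attached to a map `F : M → M`, a scalar `b : M` and a
functional `π : L → M`. -/
def clubSet {M L : Type*} [Field M] [Field L] [Algebra M L] (F : M → M) (b : M)
    (π : L →ₗ[M] M) : Set (L × L) :=
  {p | ∃ x, p.1 = algebraMap M L (F x) ∧ π p.2 = b * x}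

/-- The functional of a club is determined, up to a scalar, by the club. -/
lemma functional_eq_zero_iff {M L : Type*} [Field M] [Field L] [Algebra M L] (F : M → M) (b : M)
    (π : L →ₗ[M] M) (hF0 : F 0 = 0) (hF : ∃ x, F x ≠ 0) (hb : b ≠ 0) (y : L) :
    π y = 0 ↔ ∀ m : M, ((0 : L), m • y) ∈ clubSet F b π := by
  constructor
  · intro h m
    exact ⟨0, by simp [hF0], by simp [h]⟩
  · intro h
    by_contra hne
    obtain ⟨z, hz⟩ := hF
    obtain ⟨x, hx1, hx2⟩ := h (b * z / π y)
    have hx : x = z := by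
      have : b * z = b * x := by simpa [hne] using hx2
      exact (mul_left_cancel₀ hb this).symm
    subst hx
    exact hz (by simpa using hx1.symm)

/-- A point of `clubSet F b π` other than `⟨(0, 1)⟩` has weight at most one over `K`. -/
lemma mem_range_of_smul_mem_clubSet {K M L : Type*} [Field K] [Field M] [Field L] [Algebra K M]
    [Algebra M L] (F : M → M) (b : M) (π : L →ₗ[M] M) (hb : b ≠ 0) (hF0 : F 0 = 0)
    (hsc : ∀ x y, F x * y = F y * x → x ≠ 0 → ∃ μ : K, y = μ • x) (v : L × L) (hv : v.1 ≠ 0)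
    (m : M) (h1 : v ∈ clubSet F b π) (hm : algebraMap M L m • v ∈ clubSet F b π) :
    ∃ μ : K, m = algebraMap K M μ := by
  obtain ⟨x, hx1, hx2⟩ := h1
  obtain ⟨y, hy1, hy2⟩ := hm
  have hx : x ≠ 0 := by
    rintro rfl
    exact hv (by rw [hx1, hF0, map_zero])
  have hyx : y = m * x := by
    have : m * (b * x) = b * y := by simpa [← hx2] using hy2
    apply mul_left_cancel₀ hb
    linear_combination -this
  have hFy : F y = m * F x := by
    apply (algebraMap M L).injective
    rw [← hy1, map_mul, ← hx1]
    rfl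
  obtain ⟨μ, hμ⟩ := hsc x y (by rw [hFy, hyx]; ring) hx
  refine ⟨μ, mul_right_cancel₀ hx ?_⟩
  rw [← hyx, hμ, Algebra.smul_def]

section

variable {K M L : Type*} [Field K] [Field M] [Field L] [Algebra K M] [Algebra M L]
  [Finite M] [Finite L]

lemma equiv_of_clubSet_equiv (F₁ F₂ : M → M) (b₁ b₂ : M)
    (hb₁ : b₁ ≠ 0) (hb₂ : b₂ ≠ 0) (π₁ π₂ : L →ₗ[M] M) (h₁ : π₁ 1 = 1) (h₂ : π₂ 1 = 1)
    (hw : ∃ w, w ≠ 0 ∧ π₁ w = 0)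
    (hF₁0 : F₁ 0 = 0) (hF₂0 : F₂ 0 = 0) (hF₁ : ∃ x, F₁ x ≠ 0) (hF₂ : ∃ x, F₂ x ≠ 0)
    (hKM : ∃ z : M, ∀ μ : K, z ≠ algebraMap K M μ)
    (hsc : ∀ x y, F₂ x * y = F₂ y * x → x ≠ 0 → ∃ μ : K, y = μ • x)
    (ρ : L ≃+* L) (φ : (L × L) ≃+ (L × L))
    (hφ : ∀ (l : L) (v : L × L), φ (l • v) = ρ l • φ v)
    (hU : φ '' clubSet F₁ b₁ π₁ = clubSet F₂ b₂ π₂) :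
    ∃ (ρ : M ≃+* M) (φ : (M × M) ≃+ (M × M)),
      (∀ (lam : M) (v : M × M), φ (lam • v) = ρ lam • φ v) ∧
      φ '' {p : M × M | ∃ x : M, p = (F₁ x, b₁ * x)} =
        {p : M × M | ∃ x : M, p = (F₂ x, b₂ * x)} ∧
      φ '' {p : M × M | p.1 = 0} = {p : M × M | p.1 = 0} := by
  obtain ⟨τ, hτ⟩ := exists_ringEquiv_restrict (M := M) ρ
  have hmem : ∀ p, φ p ∈ clubSet F₂ b₂ π₂ ↔ p ∈ clubSet F₁ b₁ π₁ := fun p => by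
    rw [← hU, φ.injective.mem_set_image]
  have happ := semilinear_apply ρ φ hφ
  have hβ : (φ (0, 1)).1 = 0 := by
    by_contra hβ
    obtain ⟨z, hz⟩ := hKM
    obtain ⟨w, hw0, hw⟩ := hw
    have hmw := (functional_eq_zero_iff F₁ b₁ π₁ hF₁0 hF₁ hb₁ w).1 hw
    obtain ⟨μ, hμ⟩ := mem_range_of_smul_mem_clubSet (K := K) F₂ b₂ π₂ hb₂ hF₂0 hsc (φ (0, w))
      (by rw [happ]; simp [hβ, hw0]) z ((hmem _).2 (by simpa using hmw 1)) (by
        have := (hmem _).2 (hmw (τ.symm z))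
        rw [show ((0 : L), τ.symm z • w) = algebraMap M L (τ.symm z) • ((0 : L), w) by
          simp [Algebra.smul_def], hφ, hτ] at this
        simpa using this)
    exact hz μ hμ
  set α := (φ (1, 0)).1
  set γ := (φ (1, 0)).2
  set δ := (φ (0, 1)).2
  replace happ : ∀ x y, φ (x, y) = (ρ x * α, ρ x * γ + ρ y * δ) := fun x y => by
    rw [happ, hβ, mul_zero, add_zero]
  have hker : ∀ y, π₁ y = 0 → π₂ (ρ y * δ) = 0 := by
    intro y hy
    rw [functional_eq_zero_iff F₂ b₂ π₂ hF₂0 hF₂ hb₂]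
    intro m
    have := (hmem _).2 ((functional_eq_zero_iff F₁ b₁ π₁ hF₁0 hF₁ hb₁ y).1 hy (τ.symm m))
    rw [happ] at this
    simpa [Algebra.smul_def, hτ, mul_assoc] using this
  have hfun : ∀ y, π₂ (ρ y * δ) = τ (π₁ y) * π₂ δ := by
    intro y
    have := hker (y - algebraMap M L (π₁ y)) (by
      simp [Algebra.algebraMap_eq_smul_one, h₁])
    rw [map_sub, hτ, sub_mul, map_sub, ← Algebra.smul_def, map_smul, sub_eq_zero] at this
    exact this
  have hα0 : α ≠ 0 := by
    intro hα
    obtain ⟨⟨x, y⟩, hxy⟩ := φ.surjective (1, 0)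
    rw [happ, hα] at hxy
    simpa using congrArg Prod.fst hxy
  have hδ0 : δ ≠ 0 := by
    intro hδ
    have h0 : φ (0, 1) = 0 := Prod.ext hβ hδ
    simpa using φ.injective (h0.trans (map_zero φ).symm)
  have hd : π₂ δ ≠ 0 := by
    intro hd
    have := hfun (ρ.symm δ⁻¹)
    simp [hd, hδ0, h₂] at this
  obtain ⟨α', hα'⟩ : ∃ α', algebraMap M L α' = α := by
    obtain ⟨x, hx⟩ := hF₁
    obtain ⟨y, hy, -⟩ := (hmem (algebraMap M L (F₁ x), algebraMap M L (b₁ * x))).2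
      ⟨x, rfl, by simp [Algebra.algebraMap_eq_smul_one, h₁]⟩
    rw [happ, hτ] at hy
    have hne : algebraMap M L (τ (F₁ x)) ≠ 0 := by simpa using hx
    refine ⟨F₂ y / τ (F₁ x), ?_⟩
    rw [map_div₀, ← hy]
    field_simp
  have hα'0 : α' ≠ 0 := by
    rintro rfl
    exact hα0 (by rw [← hα', map_zero])
  have hred : ∀ x y, (φ (algebraMap M L x, y)).1 = algebraMap M L (α' * τ x) ∧
      π₂ (φ (algebraMap M L x, y)).2 = π₂ γ * τ x + π₂ δ * τ (π₁ y) := by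
    intro x y
    rw [happ]
    constructor
    · rw [hτ, map_mul, hα', mul_comm α]
    · rw [map_add, hfun, hτ, ← Algebra.smul_def, map_smul, smul_eq_mul]
      ring
  obtain ⟨ψ, hψ⟩ := exists_addEquiv_lowerTriangular τ α' (π₂ γ) (π₂ δ) hα'0 hd
  refine ⟨τ, ψ, fun l v => ?_, ?_, ?_⟩
  · rw [hψ, hψ]
    ext <;> simp <;> ring
  · apply Set.Subset.antisymm
    · rintro _ ⟨_, ⟨x, rfl⟩, rfl⟩
      obtain ⟨y, hy1, hy2⟩ := (hmem (algebraMap M L (F₁ x), algebraMap M L (b₁ * x))).2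
        ⟨x, rfl, by simp [Algebra.algebraMap_eq_smul_one, h₁]⟩
      rw [(hred _ _).1] at hy1
      rw [(hred _ _).2] at hy2
      refine ⟨y, ?_⟩
      rw [hψ]
      refine Prod.ext ((algebraMap M L).injective hy1) ?_
      simpa [Algebra.algebraMap_eq_smul_one, h₁] using hy2
    · rintro _ ⟨x, rfl⟩
      have hx : (algebraMap M L (F₂ x), algebraMap M L (b₂ * x)) ∈ clubSet F₂ b₂ π₂ :=
        ⟨x, rfl, by simp [Algebra.algebraMap_eq_smul_one, h₂]⟩
      rw [← hU] at hx
      obtain ⟨⟨u, v⟩, ⟨y, hu, hv⟩, hx⟩ := hx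
      obtain rfl : u = _ := hu
      obtain ⟨h3, h4⟩ := hred (F₁ y) v
      rw [hx] at h3 h4
      refine ⟨_, ⟨y, rfl⟩, ?_⟩
      rw [hψ]
      refine Prod.ext ((algebraMap M L).injective h3.symm) ?_
      change π₁ v = _ at hv
      rw [hv] at h4
      simpa [Algebra.algebraMap_eq_smul_one, h₂] using h4.symm
  · ext ⟨u, v⟩
    constructor
    · rintro ⟨p, hp, h⟩
      rw [hψ, show p.1 = 0 from hp] at h
      simpa using (congrArg Prod.fst h).symm
    · rintro hu
      refine ⟨ψ.symm (u, v), ?_, by simp⟩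
      have := congrArg Prod.fst (hψ (ψ.symm (u, v)))
      rw [AddEquiv.apply_symm_apply, show (u, v).1 = 0 from hu] at this
      change (ψ.symm (u, v)).1 = 0
      simpa only [zero_eq_mul, hα'0, false_or, map_eq_zero] using this

lemma clubSet_equiv_of_equiv (F₁ F₂ : M → M) (b₁ b₂ : M)
    (π₁ π₂ : L →ₗ[M] M) (h₁ : π₁ 1 = 1) (h₂ : π₂ 1 = 1)
    (τ : M ≃+* M) (ψ : (M × M) ≃+ (M × M))
    (hψ : ∀ (l : M) (v : M × M), ψ (l • v) = τ l • ψ v)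
    (hU : ψ '' {p : M × M | ∃ x : M, p = (F₁ x, b₁ * x)} =
      {p : M × M | ∃ x : M, p = (F₂ x, b₂ * x)})
    (hfix : ψ '' {p : M × M | p.1 = 0} = {p : M × M | p.1 = 0}) :
    ∃ (ρ : L ≃+* L) (φ : (L × L) ≃+ (L × L)),
      (∀ (lam : L) (v : L × L), φ (lam • v) = ρ lam • φ v) ∧
        φ '' clubSet F₁ b₁ π₁ = clubSet F₂ b₂ π₂ := by
  obtain ⟨ρ, hρ⟩ := exists_ringEquiv_extend (L := L) τ
  have happ := semilinear_apply τ ψ hψ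
  have hβ : (ψ (0, 1)).1 = 0 := hfix.subset ⟨(0, 1), rfl, rfl⟩
  set α := (ψ (1, 0)).1
  set γ := (ψ (1, 0)).2
  set δ := (ψ (0, 1)).2
  replace happ : ∀ x y, ψ (x, y) = (τ x * α, τ x * γ + τ y * δ) := fun x y => by
    rw [happ, hβ, mul_zero, add_zero]
  have hα0 : α ≠ 0 := by
    intro hα
    obtain ⟨⟨x, y⟩, hxy⟩ := ψ.surjective (1, 0)
    rw [happ, hα] at hxy
    simpa using congrArg Prod.fst hxy
  have hδ0 : δ ≠ 0 := by
    intro hδ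
    have h0 : ψ (0, 1) = 0 := Prod.ext hβ hδ
    simpa using ψ.injective (h0.trans (map_zero ψ).symm)
  let θ : L →ₗ[M] M :=
    { toFun := fun y => δ * τ (π₁ (ρ.symm y))
      map_add' := fun x y => by simp only [map_add, mul_add]
      map_smul' := fun m y => by
        have : ρ.symm (m • y) = τ.symm m • ρ.symm y := by
          rw [RingEquiv.symm_apply_eq, Algebra.smul_def, Algebra.smul_def, map_mul, hρ]
          simp
        rw [this, map_smul, smul_eq_mul, map_mul, RingEquiv.apply_symm_apply, RingHom.id_apply,
          smul_eq_mul]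
        ring }
  obtain ⟨c, hc⟩ := exists_mul_functional π₂ θ h₂
  have hc0 : c ≠ 0 := by
    rintro rfl
    have : 0 = δ * τ (π₁ (ρ.symm 1)) := by
      rw [← map_zero π₂, ← zero_mul (1 : L)]; exact hc 1
    exact hδ0 (by simpa [h₁] using this.symm)
  obtain ⟨φ, hφ⟩ := exists_addEquiv_lowerTriangular ρ (algebraMap M L α) (algebraMap M L γ) c
    (by simpa using hα0) hc0
  have hred : ∀ x y, φ (algebraMap M L x, y) =
      (algebraMap M L (ψ (x, π₁ y)).1, algebraMap M L (γ * τ x) + c * ρ y) ∧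
      π₂ (algebraMap M L (γ * τ x) + c * ρ y) = (ψ (x, π₁ y)).2 := by
    intro x y
    rw [hφ, happ]
    constructor
    · simp only [hρ, map_mul, mul_comm (algebraMap M L α)]
    · have : θ (ρ y) = δ * τ (π₁ y) := by simp [θ]
      rw [map_add, hc, this, Algebra.algebraMap_eq_smul_one, map_smul, h₂, smul_eq_mul]
      ring
  refine ⟨ρ, φ, fun l v => ?_, ?_⟩
  · rw [hφ, hφ]
    ext <;> simp <;> ring
  · apply Set.Subset.antisymm
    · rintro _ ⟨⟨u, y⟩, ⟨x, hu, hy⟩, rfl⟩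
      obtain rfl : u = _ := hu
      change π₁ y = _ at hy
      obtain ⟨z, hz⟩ := hU.subset ⟨_, ⟨x, rfl⟩, rfl⟩
      obtain ⟨h3, h4⟩ := hred (F₁ x) y
      rw [hy, hz] at h3 h4
      rw [h3]
      exact ⟨z, rfl, h4⟩
    · rintro ⟨u, y⟩ ⟨x, hu, hy⟩
      obtain rfl : u = _ := hu
      change π₂ y = _ at hy
      obtain ⟨_, ⟨z, rfl⟩, hz⟩ := hU.superset ⟨x, rfl⟩
      obtain ⟨v, rfl⟩ : ∃ v, algebraMap M L (γ * τ (F₁ z)) + c * ρ v = y :=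
        ⟨ρ.symm (c⁻¹ * (y - algebraMap M L (γ * τ (F₁ z)))), by
          rw [RingEquiv.apply_symm_apply, mul_inv_cancel_left₀ hc0, add_sub_cancel]⟩
      obtain ⟨h3, h4⟩ := hred (F₁ z) v
      have hv : π₁ v = b₁ * z := by
        have h5 := congrArg Prod.snd hz
        rw [hy, happ] at h4
        rw [happ] at h5
        simp only at h4 h5
        have h6 : τ (π₁ v) = τ (b₁ * z) := mul_right_cancel₀ hδ0 (by linear_combination -h5 - h4)
        exact τ.injective h6
      refine ⟨(algebraMap M L (F₁ z), v), ⟨z, rfl, hv⟩, ?_⟩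
      rw [h3, hv, hz]

end

lemma eq_clubSet {M L : Type*} [Field M] [Field L] [Algebra M L] {r : ℕ} {ω : L}
    {π : L →ₗ[M] M} (hπ : ∀ y m, π y = m ↔ ∃ x : Fin (r - 1) → M, y = algebraMap M L m +
        ∑ i : Fin (r - 1), algebraMap M L (x i) * ω ^ ((i : ℕ) + 1)) (F : M → M) (b : M) :
    {p : L × L | ∃ (x₀ : M) (x : Fin (r - 1) → M),
        p = (algebraMap M L (F x₀),
          algebraMap M L (b * x₀) +
            ∑ i : Fin (r - 1), algebraMap M L (x i) * ω ^ ((i : ℕ) + 1))} = clubSet F b π := by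
  ext ⟨u, y⟩
  simp only [clubSet, Set.mem_ofPred_eq, hπ, Prod.mk.injEq, exists_and_left]

lemma scattered_sub_mul {K M : Type*} [Field K] [Field M] [Algebra K M] (f : M → M)
    (hsc : ∀ m x y : M, f x = m * x → f y = m * y → x ≠ 0 → ∃ μ : K, y = μ • x) (a x y : M)
    (h : (f x - a * x) * y = (f y - a * y) * x) (hx : x ≠ 0) : ∃ μ : K, y = μ • x := by
  refine hsc (f x / x) x y (div_mul_cancel₀ _ hx).symm ?_ hx
  field_simp
  linear_combination -h

lemma exists_scattered_sub_mul_ne_zero {K M : Type*} [Field K] [Field M] [Algebra K M]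
    (f : M → M) (hM : 1 < Module.finrank K M)
    (hsc : ∀ m x y : M, f x = m * x → f y = m * y → x ≠ 0 → ∃ μ : K, y = μ • x) (a : M) :
    ∃ x, f x - a * x ≠ 0 := by
  by_contra! h
  refine hM.not_ge (finrank_le_one (1 : M) fun y => ?_)
  obtain ⟨μ, hμ⟩ := hsc a 1 y (sub_eq_zero.1 (h 1)) (sub_eq_zero.1 (h y)) one_ne_zero
  exact ⟨μ, hμ.symm⟩

/-- Theorem `th:equivscattclub`: `ΓL(2,q^n)`-equivalence of the clubs of
Construction `constr:clubviascattered` reduces to `ΓL(2,q^t)`-equivalence of the associated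
scattered subspaces, fixing `⟨(0,1)⟩`. Here `K = 𝔽_q ⊆ M = 𝔽_{q^t} ⊆ L = 𝔽_{q^n}`. -/
theorem stmt_11 (q n t r : ℕ) (K M L : Type*) [Field K] [Field M] [Field L]
    [Algebra K M] [Algebra M L] [Algebra K L] [IsScalarTower K M L]
    [Fintype K] [Fintype M] [Fintype L]
    (hq : Fintype.card K = q) (ht : Module.finrank K M = t)
    (hr : Module.finrank M L = r) (hn : n = r * t)
    (ht1 : 1 < t) (hr1 : 1 < r)
    -- the two scattered q-polynomials over 𝔽_{q^t}
    (c₁ c₂ : Fin t → M) (f₁ f₂ : M → M)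
    (hf₁ : ∀ x, f₁ x = ∑ i : Fin t, c₁ i * x ^ q ^ (i : ℕ))
    (hf₂ : ∀ x, f₂ x = ∑ i : Fin t, c₂ i * x ^ q ^ (i : ℕ))
    (hsc₁ : ∀ m x y : M, f₁ x = m * x → f₁ y = m * y → x ≠ 0 → ∃ μ : K, y = μ • x)
    (hsc₂ : ∀ m x y : M, f₂ x = m * x → f₂ y = m * y → x ≠ 0 → ∃ μ : K, y = μ • x)
    (a₁ a₂ b₁ b₂ : M) (hb₁ : b₁ ≠ 0) (hb₂ : b₂ ≠ 0)
    -- ω₁, ω₂ give 𝔽_{q^t}-bases 1, ω, …, ω^{r-1} of 𝔽_{q^n}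
    (ω₁ ω₂ : L)
    (hω₁li : LinearIndependent M (fun i : Fin r => ω₁ ^ (i : ℕ)))
    (hω₁sp : Submodule.span M (Set.range fun i : Fin r => ω₁ ^ (i : ℕ)) = ⊤)
    (hω₂li : LinearIndependent M (fun i : Fin r => ω₂ ^ (i : ℕ)))
    (hω₂sp : Submodule.span M (Set.range fun i : Fin r => ω₂ ^ (i : ℕ)) = ⊤)
    -- the subspaces U₁, U₂ of 𝔽_{q^n}²
    (U₁ U₂ : Set (L × L))
    (hU₁ : U₁ = {p : L × L | ∃ (x₀ : M) (x : Fin (r - 1) → M),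
        p = (algebraMap M L (f₁ x₀ - a₁ * x₀),
          algebraMap M L (b₁ * x₀) +
            ∑ i : Fin (r - 1), algebraMap M L (x i) * ω₁ ^ ((i : ℕ) + 1))})
    (hU₂ : U₂ = {p : L × L | ∃ (x₀ : M) (x : Fin (r - 1) → M),
        p = (algebraMap M L (f₂ x₀ - a₂ * x₀),
          algebraMap M L (b₂ * x₀) +
            ∑ i : Fin (r - 1), algebraMap M L (x i) * ω₂ ^ ((i : ℕ) + 1))}) :
    -- U₁ and U₂ are ΓL(2,q^n)-equivalent
    (∃ (ρ : L ≃+* L) (φ : (L × L) ≃+ (L × L)),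
      (∀ (lam : L) (v : L × L), φ (lam • v) = ρ lam • φ v) ∧ φ '' U₁ = U₂)
    ↔
    -- iff Ū_{f₁} and Ū_{f₂} are ΓL(2,q^t)-equivalent via a map fixing ⟨(0,1)⟩_{𝔽_{q^t}}
    (∃ (ρ : M ≃+* M) (φ : (M × M) ≃+ (M × M)),
      (∀ (lam : M) (v : M × M), φ (lam • v) = ρ lam • φ v) ∧
      φ '' {p : M × M | ∃ x : M, p = (f₁ x - a₁ * x, b₁ * x)} =
        {p : M × M | ∃ x : M, p = (f₂ x - a₂ * x, b₂ * x)} ∧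
      φ '' {p : M × M | p.1 = 0} = {p : M × M | p.1 = 0}) := by
  obtain ⟨π₁, h₁, hw, hπ₁⟩ := exists_constantCoeff r hr1 ω₁ hω₁li hω₁sp
  obtain ⟨π₂, h₂, -, hπ₂⟩ := exists_constantCoeff r hr1 ω₂ hω₂li hω₂sp
  rw [eq_clubSet hπ₁ (fun x => f₁ x - a₁ * x) b₁] at hU₁
  rw [eq_clubSet hπ₂ (fun x => f₂ x - a₂ * x) b₂] at hU₂
  subst hU₁ hU₂ ht
  have hq0 : q ≠ 0 := hq ▸ Fintype.card_ne_zero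
  constructor
  · rintro ⟨ρ, φ, hφ, hU⟩
    refine equiv_of_clubSet_equiv (K := K) _ _ b₁ b₂ hb₁ hb₂ π₁ π₂ h₁ h₂ hw ?_ ?_
      (exists_scattered_sub_mul_ne_zero f₁ ht1 hsc₁ a₁)
      (exists_scattered_sub_mul_ne_zero f₂ ht1 hsc₂ a₂) ?_
      (scattered_sub_mul f₂ hsc₂ a₂) ρ φ hφ hU
    · simp [hf₁, hq0]
    · simp [hf₂, hq0]
    · by_contra! h
      refine ht1.not_ge (finrank_le_one (1 : M) fun z => ?_)
      obtain ⟨μ, rfl⟩ := h z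
      exact ⟨μ, (Algebra.algebraMap_eq_smul_one μ).symm⟩
  · rintro ⟨τ, ψ, hψ, hU, hfix⟩
    exact clubSet_equiv_of_equiv _ _ b₁ b₂ π₁ π₂ h₁ h₂ τ ψ hψ hU hfix
end

section
/- Let n ≥ 5 and consider the following 𝔽_q-subspaces of 𝔽_{q^n} (each under its stated hypotheses): S_1 = c_1·⟨1, b_1, …, b_1^{n−3}⟩_{𝔽_q}, where b_1, c_1 ∈ 𝔽_{q^n}^* and 𝔽_q(b_1) = 𝔽_{q^n}; S_2 = S̄ ⊕ c_2·⟨1, b_2, …, b_2^{t−3}⟩_{𝔽_q}, where n = t(ℓ+1) with 3 ≤ t ≤ n−3, b_2, c_2 ∈ 𝔽_{q^n}^*, [𝔽_q(b_2):𝔽_q] = t, and S̄ is an 𝔽_q(b_2)-subspace of 𝔽_{q^n} with dim_{𝔽_q(b_2)}(S̄) = ℓ and c_2·𝔽_q(b_2) ∩ S̄ = {0}; S_3 = c_3·⟨1, b_3, …, b_3^{n/2−2}⟩_{𝔽_{q²}}, where n is even, b_3, c_3 ∈ 𝔽_{q^n}^* and 𝔽_{q²}(b_3) = 𝔽_{q^n}.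 Then for any i ≠ j in {1,2,3} (for which both S_i and S_j are defined) there is no λ ∈ 𝔽_{q^n}^* and field automorphism ρ of 𝔽_{q^n} such that S_i = λ·ρ(S_j). -/
open scoped Pointwise

section Helpers

open Polynomial

/-- A subfield of a finite field is stable under every field automorphism. -/
lemma ringEquiv_algebraMap_mem_range {K L : Type*} [Field K] [Field L] [Algebra K L]
    [Finite K] (ρ : L ≃+* L) (a : K) : ρ (algebraMap K L a) ∈ (algebraMap K L).range := by
  have := Fintype.ofFinite K
  have hpow : ρ (algebraMap K L a) ^ Fintype.card K = ρ (algebraMap K L a) := by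
    rw [← map_pow, ← map_pow, FiniteField.pow_card]
  have hsplits : (X ^ Fintype.card K - X : K[X]).Splits := by
    rw [splits_iff_card_roots, FiniteField.roots_X_pow_card_sub_X,
      FiniteField.X_pow_card_sub_X_natDegree_eq K Fintype.one_lt_card]
    rfl
  exact hsplits.mem_range_of_isRoot
    (FiniteField.X_pow_card_sub_X_ne_zero K Fintype.one_lt_card) (by simp [hpow])

lemma pow_notMem_span_pow {K L : Type*} [Field K] [Field L] [Algebra K L] {b : L} {k : ℕ}
    (hk : k < (minpoly K b).natDegree) :
    b ^ k ∉ Submodule.span K (Set.range fun i : Fin k => b ^ (i : ℕ)) := by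
  rw [PowerBasis.mem_span_pow']
  rintro ⟨r, hr, h⟩
  have hdeg : (X ^ k - r).degree = (k : WithBot ℕ) := by
    rw [degree_sub_eq_left_of_degree_lt (by rwa [degree_X_pow]), degree_X_pow]
  have hne : X ^ k - r ≠ 0 := fun h0 => by simp [h0] at hdeg
  have := minpoly.degree_le_of_ne_zero K b hne (by simp [h])
  exact absurd (natDegree_le_natDegree this) (by rw [natDegree_eq_of_degree_eq_some hdeg]; omega)

/-- The only multiplications preserving `⟨1, b, …, b ^ (m - 3)⟩`, where `m` is the degree of `b`,
are those by scalars. -/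
lemma mem_range_of_mul_span_pow_subset {K L : Type*} [Field K] [Field L] [Algebra K L] {b e : L}
    {m : ℕ} (hm : (minpoly K b).natDegree = m) (hm3 : 3 ≤ m)
    (h : ∀ u ∈ Submodule.span K (Set.range fun i : Fin (m - 2) => b ^ (i : ℕ)),
      e * u ∈ Submodule.span K (Set.range fun i : Fin (m - 2) => b ^ (i : ℕ))) :
    e ∈ (algebraMap K L).range := by
  simp only [PowerBasis.mem_span_pow'] at h
  obtain ⟨p, hp, hpe⟩ := h 1 ⟨1, by rw [degree_one]; exact_mod_cast (by omega : 0 < m - 2), by simp⟩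
  rw [mul_one] at hpe
  by_cases hd : p.natDegree = 0
  · rw [eq_C_of_natDegree_eq_zero hd, aeval_C] at hpe
    exact ⟨_, hpe.symm⟩
  have hp0 : p ≠ 0 := fun h0 => hd (by simp [h0])
  have hlt : p.natDegree < m - 2 := (natDegree_lt_iff_degree_lt hp0).mpr hp
  obtain ⟨r, hr, hre⟩ := h (b ^ (m - 2 - p.natDegree))
    ⟨X ^ (m - 2 - p.natDegree), by
      rw [degree_X_pow]; exact_mod_cast (by omega : m - 2 - p.natDegree < m - 2), by simp⟩
  have hnd : (p * X ^ (m - 2 - p.natDegree)).natDegree = m - 2 := by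
    rw [natDegree_mul_X_pow _ hp0]; omega
  have hdeg : (p * X ^ (m - 2 - p.natDegree) - r).degree = ((m - 2 : ℕ) : WithBot ℕ) := by
    have h1 : (p * X ^ (m - 2 - p.natDegree)).degree = ((m - 2 : ℕ) : WithBot ℕ) := by
      rw [degree_eq_natDegree (mul_ne_zero hp0 (pow_ne_zero _ X_ne_zero)), hnd]
    rw [degree_sub_eq_left_of_degree_lt (h1 ▸ hr), h1]
  have hne : p * X ^ (m - 2 - p.natDegree) - r ≠ 0 := fun h0 => by simp [h0] at hdeg
  have hle := natDegree_le_natDegree (minpoly.degree_le_of_ne_zero K b hne (by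
    rw [map_sub, map_mul, ← hpe, ← hre, map_pow, aeval_X, sub_self]))
  rw [natDegree_eq_of_degree_eq_some hdeg] at hle
  omega

lemma exists_add_smul_of_finrank_add_one {F V : Type*} [Field F] [AddCommGroup V] [Module F V]
    [FiniteDimensional F V] {W : Submodule F V}
    (hW : Module.finrank F W + 1 = Module.finrank F V) {x : V} (hx : x ∉ W) (v : V) :
    ∃ w ∈ W, ∃ f : F, v = w + f • x := by
  have hlt : W < W ⊔ Submodule.span F {x} := by
    refine lt_of_le_of_ne le_sup_left fun h => hx ?_
    rw [h]
    exact Submodule.mem_sup_right (Submodule.mem_span_singleton_self x)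
  have htop : W ⊔ Submodule.span F {x} = ⊤ := by
    apply Submodule.eq_top_of_finrank_eq
    have h1 := Submodule.finrank_lt_finrank_of_lt hlt
    have h2 := Submodule.finrank_le (W ⊔ Submodule.span F {x})
    omega
  obtain ⟨w, hw, y, hy, hwy⟩ := Submodule.mem_sup.mp (htop ▸ Submodule.mem_top : v ∈ _)
  obtain ⟨f, rfl⟩ := Submodule.mem_span_singleton.mp hy
  exact ⟨w, hw, f, hwy.symm⟩

/-- No automorphic image of a hyperplane over an intermediate field fits in a multiple of
`⟨1, b, …, b ^ (n - 3)⟩` when `b` generates the extension of degree `n`. -/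
lemma not_hyperplane_image_subset_span_pow {K L : Type*} [Field K] [Field L] [Algebra K L]
    [Finite K] [Finite L] (hn : 3 ≤ Module.finrank K L) {b : L}
    (hb : IntermediateField.adjoin K {b} = ⊤) {F : IntermediateField K L} {W : Submodule F L}
    (hW : Module.finrank F W + 1 = Module.finrank F L) (hbot : W ≠ ⊥) {μ : L} (hμ : μ ≠ 0)
    (ρ : L ≃+* L)
    (h : ∀ w ∈ W, μ * ρ w ∈ Submodule.span K
      (Set.range fun i : Fin (Module.finrank K L - 2) => b ^ (i : ℕ))) : False := by
  have hdeg : (minpoly K b).natDegree = Module.finrank K L := by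
    rw [← IntermediateField.adjoin.finrank (Algebra.IsIntegral.isIntegral b), hb,
      IntermediateField.finrank_top']
  set n := Module.finrank K L
  set U := Submodule.span K (Set.range fun i : Fin (n - 1) => b ^ (i : ℕ))
  have hpow := pow_notMem_span_pow (K := K) (b := b) (k := n - 1) (by omega)
  have hWU : ∀ w ∈ W, μ * ρ w ∈ U := fun w hw => by
    obtain ⟨f, hf, e⟩ := PowerBasis.mem_span_pow'.mp (h w hw)
    exact PowerBasis.mem_span_pow'.mpr
      ⟨f, hf.trans_le (by exact_mod_cast (by omega : n - 2 ≤ n - 1)), e⟩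
  have hbWU : ∀ w ∈ W, b * (μ * ρ w) ∈ U := fun w hw => by
    obtain ⟨f, hf, e⟩ := PowerBasis.mem_span_pow'.mp (h w hw)
    refine PowerBasis.mem_span_pow'.mpr ⟨X * f, ?_, by rw [e, map_mul, aeval_X]⟩
    by_cases hf0 : f = 0
    · simp [hf0]
    · rw [← natDegree_lt_iff_degree_lt hf0] at hf
      rw [← natDegree_lt_iff_degree_lt (mul_ne_zero X_ne_zero hf0), natDegree_X_mul hf0]
      omega
  have hstab : ∀ w ∈ W, ρ.symm b * w ∈ W := by
    intro w hw
    by_contra hx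
    obtain ⟨w', hw', f, hf⟩ := exists_add_smul_of_finrank_add_one hW hx (ρ.symm (μ⁻¹ * b ^ (n - 1)))
    have hf' : ρ.symm (μ⁻¹ * b ^ (n - 1)) = w' + ρ.symm b * (f • w) := by
      rw [hf, mul_smul_comm]
    apply hpow
    have := congrArg (fun z => μ * ρ z) hf'
    simp only [RingEquiv.apply_symm_apply, map_add, map_mul] at this
    rw [mul_inv_cancel_left₀ hμ] at this
    rw [this, mul_add]
    refine U.add_mem (hWU _ hw') ?_
    rw [mul_left_comm]
    exact hbWU _ (W.smul_mem f hw)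
  have hall : ∀ x : L, ∀ w ∈ W, ρ.symm x * w ∈ W := by
    intro x
    have hx : x ∈ Algebra.adjoin K {b} := by
      rw [← IntermediateField.adjoin_simple_toSubalgebra_of_isAlgebraic
        (Algebra.IsAlgebraic.isAlgebraic b), hb]
      exact IntermediateField.mem_top
    induction hx using Algebra.adjoin_induction with
    | mem x hx => rwa [Set.mem_singleton_iff.mp hx]
    | algebraMap a =>
      intro w hw
      obtain ⟨a', ha'⟩ := ringEquiv_algebraMap_mem_range ρ.symm a
      rw [← ha']
      exact W.smul_mem (algebraMap K F a') hw
    | add x y _ _ ihx ihy =>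
      intro w hw
      rw [map_add, add_mul]
      exact W.add_mem (ihx w hw) (ihy w hw)
    | mul x y _ _ ihx ihy =>
      intro w hw
      rw [map_mul, mul_assoc]
      exact ihx _ (ihy w hw)
  obtain ⟨w, hw, hw0⟩ := W.ne_bot_iff.mp hbot
  apply hpow
  have hmem := hWU _ (hall (ρ (ρ.symm (μ⁻¹ * b ^ (n - 1)) * w⁻¹)) w hw)
  rwa [RingEquiv.symm_apply_apply, inv_mul_cancel_right₀ hw0, RingEquiv.apply_symm_apply,
    mul_inv_cancel_left₀ hμ] at hmem

/-- Multiplications preserving `S' ⊕ c⟨1, b, …, b ^ (t - 3)⟩` are those by scalars. -/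
lemma mem_range_of_mul_hyperplane_add_subset {K L : Type*} [Field K] [Field L] [Algebra K L]
    [Finite L] {t : ℕ} {b c e : L} (hc : c ≠ 0) (ht : 3 ≤ t)
    (hbt : (minpoly K b).natDegree = t) {F : IntermediateField K L} (hbF : b ∈ F)
    {W : Submodule F L} (hW : Module.finrank F W + 1 = Module.finrank F L)
    (hdisj : (c • (F : Set L)) ∩ (W : Set L) = {0})
    (h : ∀ s ∈ (W : Set L) + c • (Submodule.span K
        (Set.range fun i : Fin (t - 2) => b ^ (i : ℕ)) : Set L),
      e * s ∈ (W : Set L) + c • (Submodule.span K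
        (Set.range fun i : Fin (t - 2) => b ^ (i : ℕ)) : Set L)) :
    e ∈ (algebraMap K L).range := by
  set U := Submodule.span K (Set.range fun i : Fin (t - 2) => b ^ (i : ℕ))
  have hUF : ∀ u ∈ U, u ∈ F := by
    intro u hu
    obtain ⟨p, -, rfl⟩ := PowerBasis.mem_span_pow'.mp hu
    exact Algebra.adjoin_le (S := F.toSubalgebra) (Set.singleton_subset_iff.mpr hbF)
      (aeval_mem_adjoin_singleton K b)
  have hWS : ∀ w ∈ W, w ∈ (W : Set L) + c • (U : Set L) := fun w hw =>
    ⟨w, hw, 0, ⟨0, U.zero_mem, by simp⟩, by simp⟩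
  have hcS : ∀ u ∈ U, c * u ∈ (W : Set L) + c • (U : Set L) := fun u hu =>
    ⟨0, W.zero_mem, c * u, ⟨u, hu, rfl⟩, by simp⟩
  have hzero : ∀ f ∈ F, c * f ∈ W → f = 0 := fun f hf hcf => by
    have : c * f ∈ ({0} : Set L) := hdisj ▸ ⟨⟨f, hf, rfl⟩, hcf⟩
    simpa [hc] using this
  have hcW : c ∉ W := fun hcW => one_ne_zero (hzero 1 F.one_mem (by rwa [mul_one]))
  have hSU : ∀ f ∈ F, c * f ∈ (W : Set L) + c • (U : Set L) → f ∈ U := by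
    rintro f hf ⟨w, hw, _, ⟨u, hu, rfl⟩, hs⟩
    have hfu : f - u = 0 := hzero _ (F.sub_mem hf (hUF u hu)) (by
      rw [mul_sub, ← hs]; simpa using hw)
    rw [sub_eq_zero.mp hfu]
    exact hu
  have heW : ∀ w ∈ W, e * w ∈ W := by
    intro w hw
    by_contra hx
    obtain ⟨w', hw', f, hf⟩ := exists_add_smul_of_finrank_add_one hW hx (c * b ^ (t - 2))
    refine pow_notMem_span_pow (K := K) (b := b) (k := t - 2) (by omega)
      (hSU _ (pow_mem hbF _) ?_)
    obtain ⟨w'', hw'', x, hx, hs⟩ := h _ (hWS _ (W.smul_mem f hw))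
    refine ⟨w' + w'', W.add_mem hw' hw'', x, hx, ?_⟩
    rw [hf, ← mul_smul_comm, ← hs]
    exact add_assoc _ _ _
  obtain ⟨w, hw, f, hf⟩ := exists_add_smul_of_finrank_add_one hW hcW (e * c)
  have hgW : ∀ v ∈ W, (e - f) * v ∈ W := fun v hv => by
    rw [sub_mul]
    exact W.sub_mem (heW v hv) (W.smul_mem f hv)
  have hgc : (e - f) * c ∈ W := by
    rw [sub_mul, hf]
    simpa [IntermediateField.smul_def] using hw
  have heF : e = f := by
    by_contra hne
    have := Fintype.ofFinite L
    have hpow : ∀ k : ℕ, (e - f) ^ (k + 1) * c ∈ W := by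
      intro k
      induction k with
      | zero => simpa using hgc
      | succ k ih => rw [pow_succ', mul_assoc]; exact hgW _ ih
    have h1 := hpow (Fintype.card L - 1 - 1)
    rw [Nat.sub_add_cancel (by have := Fintype.one_lt_card (α := L); omega),
      FiniteField.pow_card_sub_one_eq_one _ (sub_ne_zero.mpr hne), one_mul] at h1
    exact hcW h1
  refine mem_range_of_mul_span_pow_subset hbt ht fun u hu => hSU _ ?_ ?_
  · exact F.mul_mem (heF ▸ f.2) (hUF u hu)
  · rw [mul_left_comm]
    exact h _ (hcS u hu)

lemma exists_mem_ringEquiv_apply_notMem_range {K L : Type*} [Field K] [Field L] [Algebra K L]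
    [Finite K] {E : IntermediateField K L} (hE : Module.finrank K E ≠ 1) (ρ : L ≃+* L) :
    ∃ e ∈ E, ρ e ∉ (algebraMap K L).range := by
  by_contra! hcon
  refine hE (IntermediateField.finrank_eq_one_iff.mpr (le_bot_iff.mp fun e he => ?_))
  obtain ⟨a, ha⟩ := hcon e he
  obtain ⟨a', ha'⟩ := ringEquiv_algebraMap_mem_range ρ.symm a
  exact IntermediateField.mem_bot.mpr ⟨a', by rw [ha', ha, ρ.symm_apply_apply]⟩

lemma ringEquiv_mul_mem_image_of_mem {L E : Type*} [Field L] [Field E] [Algebra E L]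
    (V : Submodule E L) (lam c : L) (ρ : L ≃+* L) (e : E) {s : L}
    (hs : s ∈ lam • (ρ '' (c • (V : Set L)))) :
    ρ (algebraMap E L e) * s ∈ lam • (ρ '' (c • (V : Set L))) := by
  obtain ⟨_, ⟨_, ⟨v, hv, rfl⟩, rfl⟩, rfl⟩ := hs
  refine ⟨_, ⟨_, ⟨e • v, V.smul_mem e hv, rfl⟩, rfl⟩, ?_⟩
  simp only [smul_eq_mul, map_mul, Algebra.smul_def]
  ring

end Helpers

set_option synthInstance.maxHeartbeats 1000000 in
set_option maxHeartbeats 1000000 in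
/-- Lemma `lem:sisjinequivalent`: no two of the three types of
subspaces `S₁, S₂, S₃` are related by `S_i = λ·ρ(S_j)` with `λ ∈ 𝔽_{q^n}^*` and
`ρ ∈ Aut(𝔽_{q^n})`. Each part carries the hypotheses defining the two subspaces
involved; `E` plays the role of the subfield `𝔽_{q²}`. -/
theorem stmt_12 (q n : ℕ) (K L : Type*) [Field K] [Field L] [Algebra K L]
    [Fintype K] [Fintype L]
    (hq : Fintype.card K = q) (hn : Module.finrank K L = n) (hn5 : 5 ≤ n) :
    -- S₁ versus S₂
    (∀ b₁ c₁ : L, b₁ ≠ 0 → c₁ ≠ 0 → IntermediateField.adjoin K {b₁} = ⊤ →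
      ∀ (t ℓ : ℕ) (b₂ c₂ : L), b₂ ≠ 0 → c₂ ≠ 0 → 3 ≤ t → t ≤ n - 3 →
        n = t * (ℓ + 1) → Module.finrank K ↥(IntermediateField.adjoin K {b₂}) = t →
        ∀ S' : Submodule ↥(IntermediateField.adjoin K {b₂}) L,
          Module.finrank ↥(IntermediateField.adjoin K {b₂}) ↥S' = ℓ →
          (c₂ • ((IntermediateField.adjoin K {b₂} : IntermediateField K L) : Set L)) ∩
            (S' : Set L) = {0} →
          ∀ lam : L, lam ≠ 0 → ∀ ρ : L ≃+* L,
            (c₁ • ((Submodule.span K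
                (Set.range fun i : Fin (n - 2) => b₁ ^ (i : ℕ)) : Submodule K L) : Set L)) ≠
              lam • (ρ '' ((S' : Set L) +
                c₂ • ((Submodule.span K
                  (Set.range fun i : Fin (t - 2) => b₂ ^ (i : ℕ)) : Submodule K L) : Set L)))) ∧
    -- S₁ versus S₃
    (∀ b₁ c₁ : L, b₁ ≠ 0 → c₁ ≠ 0 → IntermediateField.adjoin K {b₁} = ⊤ →
      Even n →
      ∀ E : IntermediateField K L, Module.finrank K ↥E = 2 →
        ∀ b₃ c₃ : L, b₃ ≠ 0 → c₃ ≠ 0 →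
          IntermediateField.adjoin (↥E) ({b₃} : Set L) = ⊤ →
          ∀ lam : L, lam ≠ 0 → ∀ ρ : L ≃+* L,
            (c₁ • ((Submodule.span K
                (Set.range fun i : Fin (n - 2) => b₁ ^ (i : ℕ)) : Submodule K L) : Set L)) ≠
              lam • (ρ '' (c₃ • ((Submodule.span ↥E
                (Set.range fun i : Fin (n / 2 - 1) => b₃ ^ (i : ℕ)) :
                  Submodule ↥E L) : Set L)))) ∧
    -- S₂ versus S₃
    (∀ (t ℓ : ℕ) (b₂ c₂ : L), b₂ ≠ 0 → c₂ ≠ 0 → 3 ≤ t → t ≤ n - 3 →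
      n = t * (ℓ + 1) → Module.finrank K ↥(IntermediateField.adjoin K {b₂}) = t →
      ∀ S' : Submodule ↥(IntermediateField.adjoin K {b₂}) L,
        Module.finrank ↥(IntermediateField.adjoin K {b₂}) ↥S' = ℓ →
        (c₂ • ((IntermediateField.adjoin K {b₂} : IntermediateField K L) : Set L)) ∩
          (S' : Set L) = {0} →
        Even n →
        ∀ E : IntermediateField K L, Module.finrank K ↥E = 2 →
          ∀ b₃ c₃ : L, b₃ ≠ 0 → c₃ ≠ 0 →
            IntermediateField.adjoin (↥E) ({b₃} : Set L) = ⊤ →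
            ∀ lam : L, lam ≠ 0 → ∀ ρ : L ≃+* L,
              ((S' : Set L) + c₂ • ((Submodule.span K
                  (Set.range fun i : Fin (t - 2) => b₂ ^ (i : ℕ)) : Submodule K L) : Set L)) ≠
                lam • (ρ '' (c₃ • ((Submodule.span ↥E
                  (Set.range fun i : Fin (n / 2 - 1) => b₃ ^ (i : ℕ)) :
                    Submodule ↥E L) : Set L)))) := by
  have hdim : ∀ {t ℓ : ℕ} {F : IntermediateField K L} {W : Submodule F L}, 3 ≤ t →
      n = t * (ℓ + 1) → Module.finrank K F = t → Module.finrank F W = ℓ →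
      Module.finrank F W + 1 = Module.finrank F L := by
    intro t ℓ F W ht hnt hF hW
    have h := Module.finrank_mul_finrank K F L
    rw [hn, hnt, hF] at h
    rw [hW, Nat.eq_of_mul_eq_mul_left (by omega) h]
  subst hn
  refine ⟨?_, ?_, ?_⟩
  · intro b₁ c₁ _ hc₁ hb₁ t ℓ b₂ c₂ _ hc₂ ht htn hnt hF W hW _ lam hlam ρ heq
    refine not_hyperplane_image_subset_span_pow (by omega) hb₁ (hdim ht hnt hF hW) ?_
      (mul_ne_zero (inv_ne_zero hc₁) hlam) ρ (fun w hw => ?_)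
    · rintro rfl
      rw [finrank_bot] at hW
      subst hW
      omega
    · have hmem : lam • ρ w ∈ c₁ • ((Submodule.span K (Set.range fun i :
          Fin (Module.finrank K L - 2) => b₁ ^ (i : ℕ)) : Submodule K L) : Set L) := by
        rw [heq]
        exact ⟨_, ⟨w, ⟨w, hw, 0, ⟨0, Submodule.zero_mem _, by simp⟩, by simp⟩, rfl⟩, rfl⟩
      rwa [Set.mem_smul_set_iff_inv_smul_mem₀ hc₁, smul_eq_mul, smul_eq_mul, ← mul_assoc] at hmem
  · intro b₁ c₁ _ hc₁ hb₁ _ E hE b₃ c₃ _ _ _ lam _ ρ heq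
    obtain ⟨e, he, hρe⟩ := exists_mem_ringEquiv_apply_notMem_range (E := E) (by omega) ρ
    have hdeg : (minpoly K b₁).natDegree = Module.finrank K L := by
      rw [← IntermediateField.adjoin.finrank (Algebra.IsIntegral.isIntegral b₁), hb₁,
        IntermediateField.finrank_top']
    refine hρe (mem_range_of_mul_span_pow_subset hdeg (by omega) fun u hu => ?_)
    have hmem := Set.smul_mem_smul_set (a := c₁) (SetLike.mem_coe.mpr hu)
    rw [heq] at hmem
    have h := ringEquiv_mul_mem_image_of_mem _ _ _ ρ (⟨e, he⟩ : E) hmem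
    rw [← heq, Set.mem_smul_set_iff_inv_smul_mem₀ hc₁, smul_eq_mul, smul_eq_mul, mul_left_comm,
      inv_mul_cancel_left₀ hc₁] at h
    exact h
  · intro t ℓ b₂ c₂ _ hc₂ ht _ hnt hF W hW hdisj _ E hE b₃ c₃ _ _ _ lam _ ρ heq
    obtain ⟨e, he, hρe⟩ := exists_mem_ringEquiv_apply_notMem_range (E := E) (by omega) ρ
    refine hρe (mem_range_of_mul_hyperplane_add_subset hc₂ ht
      ((IntermediateField.adjoin.finrank (Algebra.IsIntegral.isIntegral b₂)).symm.trans hF)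
      (IntermediateField.mem_adjoin_simple_self K b₂)
      (hdim ht hnt hF hW) hdisj fun s hs => ?_)
    rw [heq] at hs ⊢
    exact ringEquiv_mul_mem_image_of_mem _ _ _ ρ (⟨e, he⟩ : E) hs
end

section
/- Let n ≥ 5 and consider the following 𝔽_q-subspaces of 𝔽_{q^n}² (each under its stated hypotheses): (1) U_1 = {(Σ_{i=0}^{n−3} c_1 x_i b_1^i + α + β a_1, α + β b_1) : x_0,…,x_{n−3}, α, β ∈ 𝔽_q}, where a_1, b_1, c_1 ∈ 𝔽_{q^n}^*, 𝔽_q(b_1) = 𝔽_{q^n}, 1 ∈ c_1·⟨1, b_1, …, b_1^{n−2}⟩_{𝔽_q} and a_1 ∉ c_1·⟨1, b_1, …, b_1^{n−2}⟩_{𝔽_q}; (2) U_2 = {(s̄ + Σ_{i=0}^{t−3} c_2 x_i b_2^i + α + β a_2, α + β b_2) : x_i, α, β ∈ 𝔽_q, s̄ ∈ S̄}, where n = t(ℓ+1) with 3 ≤ t ≤ n−3, a_2, b_2, c_2 ∈ 𝔽_{q^n}^*, [𝔽_q(b_2):𝔽_q] = t, S̄ is an 𝔽_q(b_2)-subspace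 with dim_{𝔽_q(b_2)}(S̄) = ℓ and c_2·𝔽_q(b_2) ∩ S̄ = {0}, 1 ∈ S̄ ⊕ c_2·⟨1, b_2, …, b_2^{t−2}⟩_{𝔽_q} and a_2 ∉ S̄ ⊕ c_2·⟨1, b_2, …, b_2^{t−2}⟩_{𝔽_q}; (3) U_3 = {(Σ_{i=0}^{n/2−2} c_3 x_i γ^i + α + β a_3, α + β b_3) : x_i ∈ 𝔽_{q²}, α, β ∈ 𝔽_q}, where n is even, a_3, b_3, c_3, γ ∈ 𝔽_{q^n}^*, 𝔽_q(b_3) = 𝔽_{q²}, 𝔽_{q²}(γ) = 𝔽_{q^n}, 1 ∈ c_3·⟨1, γ, …, γ^{n/2−2}⟩_{𝔽_{q²}} and a_3 ∉ c_3·⟨1, γ, …, γ^{n/2−2}⟩_{𝔽_{q²}}. Then for any i ≠ j in {1,2,3} (for which both U_i and U_j are defined), U_i and U_j are not ΓL(2,q^n)-equivalent. -/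
open scoped Pointwise

/-- If `b` is fixed by the `d`-th power of the `#K`-Frobenius, then `[K(b) : K] ≤ d`. -/
lemma finrank_adjoin_le_of_pow_eq_self {K L : Type*} [Field K] [Field L] [Algebra K L]
    [Fintype K] [Fintype L] {b : L} {d : ℕ} (hd : d ≠ 0)
    (hb : b ^ Fintype.card K ^ d = b) :
    Module.finrank K (IntermediateField.adjoin K {b}) ≤ d := by
  classical
  have hK : 1 < Fintype.card K := Fintype.one_lt_card
  have hfix : ∀ x ∈ IntermediateField.adjoin K {b}, x ^ Fintype.card K ^ d = x := by
    obtain ⟨p, hp⟩ := CharP.exists K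
    obtain ⟨m, hpp, hm⟩ := FiniteField.card K p
    have : Fact p.Prime := ⟨hpp⟩
    have : CharP L p := charP_of_injective_algebraMap (algebraMap K L).injective p
    intro x hx
    induction hx using IntermediateField.adjoin_induction with
    | mem x hx =>
      rw [Set.mem_singleton_iff] at hx
      rw [hx, hb]
    | algebraMap x => rw [← map_pow, FiniteField.pow_card_pow]
    | add x y _ _ hx hy =>
      have h := add_pow_char_pow (p := p) (n := m * d) x y
      rw [pow_mul, ← hm, hx, hy] at h
      exact h
    | inv x _ hx => rw [inv_pow, hx]
    | mul x y _ _ hx hy => rw [mul_pow, hx, hy]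
  have hne : (Polynomial.X ^ Fintype.card K ^ d - Polynomial.X : Polynomial L) ≠ 0 :=
    FiniteField.X_pow_card_pow_sub_X_ne_zero L hd hK
  have hcard : Nat.card (IntermediateField.adjoin K {b}) ≤ Fintype.card K ^ d := by
    have hsub : ((IntermediateField.adjoin K {b} : IntermediateField K L) : Set L) ⊆
        (Polynomial.X ^ Fintype.card K ^ d - Polynomial.X : Polynomial L).roots.toFinset := by
      intro x hx
      simp only [Finset.mem_coe, Multiset.mem_toFinset, Polynomial.mem_roots hne,
        Polynomial.IsRoot.def, Polynomial.eval_sub, Polynomial.eval_pow, Polynomial.eval_X]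
      rw [hfix x hx, sub_self]
    calc Nat.card (IntermediateField.adjoin K {b})
        ≤ (Polynomial.X ^ Fintype.card K ^ d - Polynomial.X : Polynomial L).roots.toFinset.card := by
          rw [← Set.ncard_coe_finset]
          exact Set.ncard_le_ncard hsub (Set.toFinite _)
      _ ≤ _ := (Multiset.toFinset_card_le _).trans (Polynomial.card_roots' _)
      _ = _ := FiniteField.X_pow_card_pow_sub_X_natDegree_eq L hd hK
  rw [Module.natCard_eq_pow_finrank (K := K), Nat.card_eq_fintype_card] at hcard
  exact (Nat.pow_le_pow_iff_right hK).1 hcard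

/-- A semilinear map sending `V × 0 + ⟨(1, 1), (a, b)⟩` into `V' × 0 + ⟨(1, 1), (a', b')⟩` sends
`(1, 0)` to a multiple of itself as soon as `dim V ≥ 3`, and then it carries the second
coordinates `⟨1, b⟩` into a multiple of `⟨1, b'⟩`; hence `[K(b) : K] ≤ [K(b') : K]`. -/
lemma finrank_adjoin_le_of_semilinear_image {K L : Type*} [Field K] [Field L] [Algebra K L]
    [Fintype K] [Fintype L] {V V' : Submodule K L} {a b a' b' : L}
    (hV : 3 ≤ Module.finrank K V) (ρ : L ≃+* L) (φ : (L × L) ≃+ (L × L))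
    (hφ : ∀ (lam : L) (v : L × L), φ (lam • v) = ρ lam • φ v)
    (hU : φ '' ((V.prod ⊥ ⊔ Submodule.span K {((1 : L), (1 : L))} ⊔
        Submodule.span K {(a, b)} : Submodule K (L × L)) : Set (L × L)) =
      ((V'.prod ⊥ ⊔ Submodule.span K {((1 : L), (1 : L))} ⊔
        Submodule.span K {(a', b')} : Submodule K (L × L)) : Set (L × L))) :
    Module.finrank K (IntermediateField.adjoin K {b}) ≤
      Module.finrank K (IntermediateField.adjoin K {b'}) := by
  have hle : V'.prod ⊥ ⊔ Submodule.span K {((1 : L), (1 : L))} ⊔ Submodule.span K {(a', b')} ≤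
      (Submodule.span K {1, b'}).comap (LinearMap.snd K L L) := by
    refine sup_le (sup_le ?_ ?_) ?_
    · rintro ⟨x, y⟩ ⟨-, hy⟩
      obtain rfl : y = 0 := hy
      exact zero_mem (Submodule.span K {1, b'})
    · rw [Submodule.span_singleton_le_iff_mem]
      exact Submodule.subset_span (by simp)
    · rw [Submodule.span_singleton_le_iff_mem]
      exact Submodule.subset_span (by simp)
  have hmaps : ∀ v ∈ V.prod ⊥ ⊔ Submodule.span K {((1 : L), (1 : L))} ⊔
      Submodule.span K {(a, b)}, (φ v).2 ∈ Submodule.span K {1, b'} := fun v hv =>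
    hle (hU.subset (Set.mem_image_of_mem φ hv))
  have hfst : ∀ x : L, φ (x, 0) = ρ x • φ (1, 0) := fun x => by
    rw [← hφ, Prod.smul_mk, smul_eq_mul, mul_one, smul_zero]
  have hsnd : ∀ y : L, φ (0, y) = ρ y • φ (0, 1) := fun y => by
    rw [← hφ, Prod.smul_mk, smul_zero, smul_eq_mul, mul_one]
  have hfix : (φ (1, 0)).2 = 0 := by
    by_contra hne
    have hf : ∀ v : V, ρ v * (φ (1, 0)).2 ∈ Submodule.span K {1, b'} := fun v => by
      have h := hmaps ((v : L), 0) (Submodule.mem_sup_left (Submodule.mem_sup_left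
        ⟨v.2, Submodule.zero_mem _⟩))
      rwa [hfst] at h
    have hinj : Function.Injective
        fun v : V => (⟨_, hf v⟩ : Submodule.span K {(1 : L), b'}) := fun v w hvw =>
      Subtype.ext (ρ.injective (mul_right_cancel₀ hne (congrArg Subtype.val hvw)))
    have hcard := Nat.card_le_card_of_injective _ hinj
    rw [Module.natCard_eq_pow_finrank (K := K) (V := V),
      Module.natCard_eq_pow_finrank (K := K) (V := Submodule.span K {(1 : L), b'})] at hcard
    have hVW := (Nat.pow_le_pow_iff_right (Finite.one_lt_card (α := K))).1 hcard
    classical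
    have hW : Module.finrank K (Submodule.span K {(1 : L), b'}) ≤ 2 := by
      have h := finrank_span_finset_le_card (R := K) ({1, b'} : Finset L)
      rw [Finset.coe_pair] at h
      exact h.trans Finset.card_le_two
    omega
  have hφ2 : ∀ x y : L, (φ (x, y)).2 = ρ y * (φ (0, 1)).2 := fun x y => by
    have h : (x, y) = (x, 0) + (0, y) := by simp
    rw [h, map_add, hfst, hsnd]
    simp [hfix]
  have hν : (φ (0, 1)).2 ≠ 0 := fun h0 => by
    obtain ⟨⟨x, y⟩, hxy⟩ := φ.surjective (0, 1)
    have h := hφ2 x y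
    rw [hxy, h0, mul_zero] at h
    exact one_ne_zero h
  have hspan : Submodule.span K {1, b'} ≤
      Subalgebra.toSubmodule (IntermediateField.adjoin K {b'}).toSubalgebra := by
    rw [Submodule.span_le]
    rintro x (rfl | rfl)
    · exact one_mem (IntermediateField.adjoin K {b'})
    · exact IntermediateField.mem_adjoin_simple_self K x
  have hν' : (φ (0, 1)).2 ∈ IntermediateField.adjoin K {b'} := by
    have h := hspan (hmaps (1, 1) (Submodule.mem_sup_left (Submodule.mem_sup_right
      (Submodule.mem_span_singleton_self _))))
    rwa [hφ2, map_one, one_mul] at h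
  have hbν : ρ b * (φ (0, 1)).2 ∈ IntermediateField.adjoin K {b'} := by
    have h := hspan (hmaps (a, b) (Submodule.mem_sup_right
      (Submodule.mem_span_singleton_self _)))
    rwa [hφ2] at h
  have hρb : ρ b ∈ IntermediateField.adjoin K {b'} := by
    have h := div_mem hbν hν'
    rwa [mul_div_cancel_right₀ _ hν] at h
  refine finrank_adjoin_le_of_pow_eq_self Module.finrank_pos.ne' (ρ.injective ?_)
  have : Fintype (IntermediateField.adjoin K {b'}) := Fintype.ofFinite _
  rw [map_pow, ← Module.card_eq_pow_finrank (K := K)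
    (V := IntermediateField.adjoin K {b'})]
  exact congrArg Subtype.val
    (FiniteField.pow_card (⟨ρ b, hρb⟩ : IntermediateField.adjoin K {b'}))

/-- Multiplication by `c ≠ 0` preserves the dimension of a subspace. -/
lemma finrank_pointwise_smul_eq {K L : Type*} [Field K] [Field L] [Algebra K L] {c : L}
    (hc : c ≠ 0) (V : Submodule K L) :
    Module.finrank K (c • V : Submodule K L) = Module.finrank K V :=
  (Submodule.equivMapOfInjective (DistribSMul.toLinearMap K L c)
    (mul_right_injective₀ hc) V).finrank_eq.symm

/-- The first `m ≤ [K(b) : K]` powers of `b` span a space of dimension `m`. -/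
lemma finrank_span_range_pow {K L : Type*} [Field K] [Field L] [Algebra K L]
    [FiniteDimensional K L] {b : L} {m : ℕ}
    (hm : m ≤ Module.finrank K (IntermediateField.adjoin K {b})) :
    Module.finrank K (Submodule.span K (Set.range fun i : Fin m => b ^ (i : ℕ))) = m := by
  have hint : IsIntegral K b := IsIntegral.of_finite K b
  rw [IntermediateField.adjoin.finrank hint] at hm
  have h := (linearIndependent_pow (K := K) b).comp (Fin.castLE hm) (Fin.castLE_injective hm)
  exact (finrank_span_eq_card h).trans (Fintype.card_fin m)

set_option synthInstance.maxHeartbeats 1000000 in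
set_option maxHeartbeats 1000000 in
/-- Theorem `th:gammaln-2club`: the three types of subspaces
`U₁, U₂, U₃` defining `(n-2)`-clubs are pairwise `ΓL(2,q^n)`-inequivalent.
Each part carries the hypotheses defining the two subspaces involved. -/
theorem stmt_13 (q n : ℕ) (K L : Type*) [Field K] [Field L] [Algebra K L]
    [Fintype K] [Fintype L]
    (hq : Fintype.card K = q) (hn : Module.finrank K L = n) (hn5 : 5 ≤ n) :
    -- U₁ versus U₂
    (∀ a₁ b₁ c₁ : L, a₁ ≠ 0 → b₁ ≠ 0 → c₁ ≠ 0 →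
      IntermediateField.adjoin K {b₁} = ⊤ →
      (1 : L) ∈ c₁ • Submodule.span K (Set.range fun i : Fin (n - 1) => b₁ ^ (i : ℕ)) →
      a₁ ∉ c₁ • Submodule.span K (Set.range fun i : Fin (n - 1) => b₁ ^ (i : ℕ)) →
      ∀ (t ℓ : ℕ) (a₂ b₂ c₂ : L), a₂ ≠ 0 → b₂ ≠ 0 → c₂ ≠ 0 → 3 ≤ t → t ≤ n - 3 →
        n = t * (ℓ + 1) → Module.finrank K ↥(IntermediateField.adjoin K {b₂}) = t →
        ∀ S' : Submodule ↥(IntermediateField.adjoin K {b₂}) L,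
          Module.finrank ↥(IntermediateField.adjoin K {b₂}) ↥S' = ℓ →
          (c₂ • ((IntermediateField.adjoin K {b₂} : IntermediateField K L) : Set L)) ∩
            (S' : Set L) = {0} →
          (1 : L) ∈ S'.restrictScalars K ⊔
            c₂ • Submodule.span K (Set.range fun i : Fin (t - 1) => b₂ ^ (i : ℕ)) →
          a₂ ∉ S'.restrictScalars K ⊔
            c₂ • Submodule.span K (Set.range fun i : Fin (t - 1) => b₂ ^ (i : ℕ)) →
          ¬ ∃ (ρ : L ≃+* L) (φ : (L × L) ≃+ (L × L)),
            (∀ (lam : L) (v : L × L), φ (lam • v) = ρ lam • φ v) ∧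
            φ '' (((c₁ • Submodule.span K
                  (Set.range fun i : Fin (n - 2) => b₁ ^ (i : ℕ))).prod ⊥ ⊔
                Submodule.span K {((1 : L), (1 : L))} ⊔
                Submodule.span K {(a₁, b₁)} : Submodule K (L × L)) : Set (L × L)) =
              (((S'.restrictScalars K ⊔ c₂ • Submodule.span K
                  (Set.range fun i : Fin (t - 2) => b₂ ^ (i : ℕ))).prod ⊥ ⊔
                Submodule.span K {((1 : L), (1 : L))} ⊔
                Submodule.span K {(a₂, b₂)} : Submodule K (L × L)) : Set (L × L))) ∧
    -- U₁ versus U₃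
    (∀ a₁ b₁ c₁ : L, a₁ ≠ 0 → b₁ ≠ 0 → c₁ ≠ 0 →
      IntermediateField.adjoin K {b₁} = ⊤ →
      (1 : L) ∈ c₁ • Submodule.span K (Set.range fun i : Fin (n - 1) => b₁ ^ (i : ℕ)) →
      a₁ ∉ c₁ • Submodule.span K (Set.range fun i : Fin (n - 1) => b₁ ^ (i : ℕ)) →
      Even n →
      ∀ a₃ b₃ c₃ γ : L, a₃ ≠ 0 → b₃ ≠ 0 → c₃ ≠ 0 → γ ≠ 0 →
        Module.finrank K ↥(IntermediateField.adjoin K {b₃}) = 2 →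
        IntermediateField.adjoin (↥(IntermediateField.adjoin K {b₃})) ({γ} : Set L) = ⊤ →
        (1 : L) ∈ c₃ • (Submodule.span ↥(IntermediateField.adjoin K {b₃})
          (Set.range fun i : Fin (n / 2 - 1) => γ ^ (i : ℕ))).restrictScalars K →
        a₃ ∉ c₃ • (Submodule.span ↥(IntermediateField.adjoin K {b₃})
          (Set.range fun i : Fin (n / 2 - 1) => γ ^ (i : ℕ))).restrictScalars K →
        ¬ ∃ (ρ : L ≃+* L) (φ : (L × L) ≃+ (L × L)),
          (∀ (lam : L) (v : L × L), φ (lam • v) = ρ lam • φ v) ∧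
          φ '' (((c₁ • Submodule.span K
                (Set.range fun i : Fin (n - 2) => b₁ ^ (i : ℕ))).prod ⊥ ⊔
              Submodule.span K {((1 : L), (1 : L))} ⊔
              Submodule.span K {(a₁, b₁)} : Submodule K (L × L)) : Set (L × L)) =
            (((c₃ • (Submodule.span ↥(IntermediateField.adjoin K {b₃})
                  (Set.range fun i : Fin (n / 2 - 1) => γ ^ (i : ℕ))).restrictScalars K).prod ⊥ ⊔
              Submodule.span K {((1 : L), (1 : L))} ⊔
              Submodule.span K {(a₃, b₃)} : Submodule K (L × L)) : Set (L × L))) ∧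
    -- U₂ versus U₃
    (∀ (t ℓ : ℕ) (a₂ b₂ c₂ : L), a₂ ≠ 0 → b₂ ≠ 0 → c₂ ≠ 0 → 3 ≤ t → t ≤ n - 3 →
      n = t * (ℓ + 1) → Module.finrank K ↥(IntermediateField.adjoin K {b₂}) = t →
      ∀ S' : Submodule ↥(IntermediateField.adjoin K {b₂}) L,
        Module.finrank ↥(IntermediateField.adjoin K {b₂}) ↥S' = ℓ →
        (c₂ • ((IntermediateField.adjoin K {b₂} : IntermediateField K L) : Set L)) ∩
          (S' : Set L) = {0} →
        (1 : L) ∈ S'.restrictScalars K ⊔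
          c₂ • Submodule.span K (Set.range fun i : Fin (t - 1) => b₂ ^ (i : ℕ)) →
        a₂ ∉ S'.restrictScalars K ⊔
          c₂ • Submodule.span K (Set.range fun i : Fin (t - 1) => b₂ ^ (i : ℕ)) →
        Even n →
        ∀ a₃ b₃ c₃ γ : L, a₃ ≠ 0 → b₃ ≠ 0 → c₃ ≠ 0 → γ ≠ 0 →
          Module.finrank K ↥(IntermediateField.adjoin K {b₃}) = 2 →
          IntermediateField.adjoin (↥(IntermediateField.adjoin K {b₃})) ({γ} : Set L) = ⊤ →
          (1 : L) ∈ c₃ • (Submodule.span ↥(IntermediateField.adjoin K {b₃})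
            (Set.range fun i : Fin (n / 2 - 1) => γ ^ (i : ℕ))).restrictScalars K →
          a₃ ∉ c₃ • (Submodule.span ↥(IntermediateField.adjoin K {b₃})
            (Set.range fun i : Fin (n / 2 - 1) => γ ^ (i : ℕ))).restrictScalars K →
          ¬ ∃ (ρ : L ≃+* L) (φ : (L × L) ≃+ (L × L)),
            (∀ (lam : L) (v : L × L), φ (lam • v) = ρ lam • φ v) ∧
            φ '' (((S'.restrictScalars K ⊔ c₂ • Submodule.span K
                  (Set.range fun i : Fin (t - 2) => b₂ ^ (i : ℕ))).prod ⊥ ⊔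
                Submodule.span K {((1 : L), (1 : L))} ⊔
                Submodule.span K {(a₂, b₂)} : Submodule K (L × L)) : Set (L × L)) =
              (((c₃ • (Submodule.span ↥(IntermediateField.adjoin K {b₃})
                    (Set.range fun i : Fin (n / 2 - 1) => γ ^ (i : ℕ))).restrictScalars K).prod ⊥ ⊔
                Submodule.span K {((1 : L), (1 : L))} ⊔
                Submodule.span K {(a₃, b₃)} : Submodule K (L × L)) : Set (L × L))) := by
  have hfin : FiniteDimensional K L := Module.Finite.of_finite
  have hV₁ : ∀ b₁ c₁ : L, c₁ ≠ 0 → IntermediateField.adjoin K {b₁} = ⊤ →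
      3 ≤ Module.finrank K (c₁ • Submodule.span K
        (Set.range fun i : Fin (n - 2) => b₁ ^ (i : ℕ)) : Submodule K L) := by
    intro b₁ c₁ hc₁ hb₁
    rw [finrank_pointwise_smul_eq hc₁, finrank_span_range_pow] <;>
      [skip; rw [hb₁, IntermediateField.finrank_top', hn]] <;> omega
  refine ⟨?_, ?_, ?_⟩
  · rintro a₁ b₁ c₁ - - hc₁ hb₁ - - t ℓ a₂ b₂ c₂ - - - ht htn - hb₂ S' - - - - ⟨ρ, φ, hφ, hU⟩
    have h := finrank_adjoin_le_of_semilinear_image (hV₁ b₁ c₁ hc₁ hb₁) ρ φ hφ hU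
    rw [hb₁, IntermediateField.finrank_top', hn, hb₂] at h
    omega
  · rintro a₁ b₁ c₁ - - hc₁ hb₁ - - - a₃ b₃ c₃ γ - - - - hb₃ - - - ⟨ρ, φ, hφ, hU⟩
    have h := finrank_adjoin_le_of_semilinear_image (hV₁ b₁ c₁ hc₁ hb₁) ρ φ hφ hU
    rw [hb₁, IntermediateField.finrank_top', hn, hb₃] at h
    omega
  · rintro t ℓ a₂ b₂ c₂ - - - ht htn hntl hb₂ S' hS' - - - - a₃ b₃ c₃ γ - - - - hb₃ - - -
      ⟨ρ, φ, hφ, hU⟩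
    have hS : Module.finrank K (S'.restrictScalars K) = t * ℓ := by
      rw [← hb₂, ← hS']
      exact (Module.finrank_mul_finrank K (IntermediateField.adjoin K {b₂}) S').symm
    have hℓ : 1 ≤ ℓ := by
      rcases Nat.eq_zero_or_pos ℓ with rfl | hℓ
      · omega
      · exact hℓ
    have hV : 3 ≤ Module.finrank K (S'.restrictScalars K ⊔ c₂ • Submodule.span K
        (Set.range fun i : Fin (t - 2) => b₂ ^ (i : ℕ)) : Submodule K L) :=
      calc 3 ≤ t * ℓ := ht.trans (Nat.le_mul_of_pos_right t hℓ)
        _ ≤ _ := hS.symm.trans_le (Submodule.finrank_mono le_sup_left)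
    have h := finrank_adjoin_le_of_semilinear_image hV ρ φ hφ hU
    rw [hb₂, hb₃] at h
    omega
end

section
/- Let λ ∈ 𝔽_{q^n}^* be such that {1, λ, …, λ^{n−1}} is an 𝔽_q-basis of 𝔽_{q^n}, and let U_λ = {(t_1 λ + … + t_{n−1} λ^{n−1}, t_{n−1} + t_n λ) : (t_1,…,t_n) ∈ 𝔽_q^n} ⊆ 𝔽_{q^n}². Then there exists ω ∈ 𝔽_{q^n} such that (1, λ, …, λ^{n−3}, λ^{n−2}+ω, ωλ) is an ordered 𝔽_q-basis of 𝔽_{q^n}; and for any such ω, letting (c_0, …, c_{n−1}) be the dual basis with respect to the trace form (i.e. Tr_{q^n/q}(c_i e_j) = δ_{ij}, where (e_0,…,e_{n−1}) = (1, λ, …, λ^{n−3}, λ^{n−2}+ω, ωλ)), the 𝔽_{q^n}-linear map g(x,y) = (λ^{−1} x + ω y, y) maps U_λ onto U_p = {(x, p(x)) : x ∈ 𝔽_{q^n}}, where p(x) = Tr_{q^n/q}(c_{n−2} x) + λ·Tr_{q^n/q}(c_{n−1} x). In particular, the linear set L_{U_λ} is PGL(2,q^n)-equivalent to L_{U_p}.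 -/
open scoped Pointwise

/-- The ordered tuple `(1, λ, …, λ^{n-3}, λ^{n-2} + ω, ωλ)`. -/
noncomputable def ordTuple {L : Type*} [Field L] (n : ℕ) (lam ω : L) : Fin n → L :=
  fun i => if (i : ℕ) < n - 2 then lam ^ (i : ℕ)
    else if (i : ℕ) = n - 2 then lam ^ (n - 2) + ω
    else ω * lam

section OrdTuple

variable {L : Type*} [Field L]

theorem ordTuple_castSucc_castSucc (m : ℕ) (lam ω : L) (i : Fin m) :
    ordTuple (m + 2) lam ω i.castSucc.castSucc = lam ^ (i : ℕ) := by
  simp [ordTuple]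

theorem ordTuple_castSucc_last (m : ℕ) (lam ω : L) :
    ordTuple (m + 2) lam ω (Fin.last m).castSucc = lam ^ m + ω := by
  simp [ordTuple]

theorem ordTuple_last (m : ℕ) (lam ω : L) :
    ordTuple (m + 2) lam ω (Fin.last (m + 1)) = ω * lam := by
  simp [ordTuple]

variable {K : Type*} [Field K] [Algebra K L]

/-- If the first `m + 3` powers of `lam` span `L`, then so does `ordTuple (m + 3) lam ω` for a
suitable `ω`. -/
theorem exists_span_ordTuple_eq_top (m : ℕ) (lam : L)
    (hspan : Submodule.span K (Set.range fun i : Fin (m + 3) => lam ^ (i : ℕ)) = ⊤) :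
    ∃ ω : L, Submodule.span K (Set.range (ordTuple (m + 3) lam ω)) = ⊤ := by
  obtain ⟨a, ha⟩ : ∃ a : Fin (m + 3) → K, ∑ i, a i • lam ^ (i : ℕ) = lam ^ (m + 3) :=
    (Submodule.mem_span_range_iff_exists_fun K).1 (hspan ▸ Submodule.mem_top)
  set s : K := 1 - a (Fin.last (m + 1)).castSucc with hs
  refine ⟨lam ^ (m + 2) - lam ^ (m + 1) + s • lam ^ m, ?_⟩
  set ω : L := lam ^ (m + 2) - lam ^ (m + 1) + s • lam ^ m with hω
  set S := Submodule.span K (Set.range (ordTuple (m + 3) lam ω)) with hS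
  have hmem (i : Fin (m + 3)) : ordTuple (m + 3) lam ω i ∈ S :=
    Submodule.subset_span (Set.mem_range_self i)
  have hlow (i : Fin (m + 1)) : lam ^ (i : ℕ) ∈ S := by
    rw [← ordTuple_castSucc_castSucc (m + 1) lam ω i]
    exact hmem _
  have htop : lam ^ (m + 2) ∈ S := by
    have h := S.sub_mem (hmem (Fin.last (m + 1)).castSucc) (S.smul_mem s (hlow (Fin.last m)))
    rw [ordTuple_castSucc_last] at h
    convert h using 1
    simp only [hω, Fin.val_last]
    ring
  have hmid : lam ^ (m + 1) ∈ S := by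
    have hsum : ∑ i : Fin (m + 1), a i.castSucc.castSucc • lam ^ (i : ℕ) ∈ S :=
      S.sum_mem fun i _ => S.smul_mem _ (hlow i)
    have h := S.sub_mem (S.sub_mem (S.add_mem (hmem (Fin.last (m + 2))) htop)
      (S.smul_mem (a (Fin.last (m + 2))) htop)) hsum
    rw [ordTuple_last] at h
    convert h using 1
    rw [Fin.sum_univ_castSucc, Fin.sum_univ_castSucc] at ha
    simp only [Fin.val_castSucc, Fin.val_last, Algebra.smul_def] at ha ⊢
    simp only [hω, hs, Algebra.smul_def, map_sub, map_one]
    linear_combination ha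
  rw [eq_top_iff, ← hspan, Submodule.span_le]
  rintro _ ⟨i, rfl⟩
  induction i using Fin.lastCases with
  | last => simpa using htop
  | cast i =>
    induction i using Fin.lastCases with
    | last => simpa using hmid
    | cast i => exact hlow i

/-- The map `(x, y) ↦ (lam⁻¹ x + ω y, y)` sends the point of the construction with parameters `t`
to the point whose first coordinate is the combination of `ordTuple` with coefficients `t`. -/
theorem inv_mul_sum_add_eq_sum_ordTuple (m : ℕ) {lam : L} (hlam : lam ≠ 0) (ω : L)
    (t : Fin (m + 2) → K) :
    lam⁻¹ * (∑ i : Fin (m + 2), if (i : ℕ) < m + 1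
        then algebraMap K L (t i) * lam ^ ((i : ℕ) + 1) else 0) +
      ω * (algebraMap K L (t (Fin.last m).castSucc) +
        algebraMap K L (t (Fin.last (m + 1))) * lam) =
      ∑ i, t i • ordTuple (m + 2) lam ω i := by
  have hlt (i : Fin m) : (i : ℕ) < m + 1 := by omega
  simp only [Fin.sum_univ_castSucc, Fin.val_castSucc, Fin.val_last, hlt, lt_add_iff_pos_right,
    zero_lt_one, lt_irrefl, if_true, if_false, ordTuple_castSucc_castSucc,
    ordTuple_castSucc_last, ordTuple_last, Algebra.smul_def, pow_succ, ← mul_assoc,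
    ← Finset.sum_mul]
  field_simp
  ring

end OrdTuple

/-- Pairing with a dual family for the trace form recovers the coefficients. -/
theorem trace_mul_sum_smul_of_dual {K L ι : Type*} [CommRing K] [CommRing L] [Algebra K L]
    [Fintype ι] [DecidableEq ι] {c e : ι → L}
    (h : ∀ i j, Algebra.trace K L (c i * e j) = if i = j then 1 else 0) (t : ι → K) (i : ι) :
    Algebra.trace K L (c i * ∑ j, t j • e j) = t i := by
  simp [Finset.mul_sum, h]

/-- Theorem `prop:policlub1`: a polynomial description of the
`(n-2)`-clubs of Construction `constr:(n-2)clubpolynomial`. -/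
theorem stmt_14 (q n : ℕ) (K L : Type*) [Field K] [Field L] [Algebra K L]
    [Fintype K] [Fintype L]
    (hq : Fintype.card K = q) (hn : Module.finrank K L = n) (hn5 : 5 ≤ n)
    (lam : L) (hlam0 : lam ≠ 0)
    (hlamli : LinearIndependent K fun i : Fin n => lam ^ (i : ℕ))
    (hlamsp : Submodule.span K (Set.range fun i : Fin n => lam ^ (i : ℕ)) = ⊤)
    (Ulam : Set (L × L))
    (hUlam : Ulam = {p : L × L | ∃ t : Fin n → K,
        p = (∑ i : Fin n, if (i : ℕ) < n - 1
              then algebraMap K L (t i) * lam ^ ((i : ℕ) + 1) else 0,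
            algebraMap K L (t ⟨n - 2, by omega⟩) +
              algebraMap K L (t ⟨n - 1, by omega⟩) * lam)}) :
    -- there exists ω making the ordered tuple a basis
    (∃ ω : L, LinearIndependent K (ordTuple n lam ω) ∧
        Submodule.span K (Set.range (ordTuple n lam ω)) = ⊤) ∧
    -- and for any such ω and dual basis c, the map g carries Ulam onto U_p
    (∀ ω : L, LinearIndependent K (ordTuple n lam ω) →
      Submodule.span K (Set.range (ordTuple n lam ω)) = ⊤ →
      ∀ c : Fin n → L,
        (∀ i j : Fin n, Algebra.trace K L (c i * ordTuple n lam ω j) =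
          if i = j then 1 else 0) →
        (fun p : L × L => (lam⁻¹ * p.1 + ω * p.2, p.2)) '' Ulam =
          {p : L × L | ∃ x : L,
            p = (x, algebraMap K L (Algebra.trace K L (c ⟨n - 2, by omega⟩ * x)) +
              lam * algebraMap K L (Algebra.trace K L (c ⟨n - 1, by omega⟩ * x)))}) := by
  obtain ⟨m, rfl⟩ : ∃ m, n = m + 3 := ⟨n - 3, by omega⟩
  refine ⟨?_, fun ω _ hsp c hc => ?_⟩
  · obtain ⟨ω, hω⟩ := exists_span_ordTuple_eq_top m lam hlamsp
    exact ⟨ω, linearIndependent_of_top_le_span_of_card_eq_finrank hω.ge (by simp [hn]), hω⟩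
  · have hcoord (t : Fin (m + 3) → K) (i : Fin (m + 3)) :=
      trace_mul_sum_smul_of_dual hc t i
    have hfst := inv_mul_sum_add_eq_sum_ordTuple (K := K) (m + 1) hlam0 ω
    ext p
    rw [hUlam]
    constructor
    · rintro ⟨_, ⟨t, rfl⟩, rfl⟩
      refine ⟨∑ i, t i • ordTuple (m + 3) lam ω i, ?_⟩
      rw [hcoord, hcoord, mul_comm lam]
      exact Prod.ext (hfst t) rfl
    · rintro ⟨x, rfl⟩
      obtain ⟨t, rfl⟩ :=
        (Submodule.mem_span_range_iff_exists_fun K).1 (hsp ▸ Submodule.mem_top (x := x))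
      refine ⟨_, ⟨t, rfl⟩, ?_⟩
      rw [hcoord, hcoord, mul_comm lam]
      exact Prod.ext (hfst t) rfl
end

section
/- Let n = rt with t, r > 1, let f(x) = Σ_{i=0}^{t−1} f_i x^{q^i} with f_i ∈ 𝔽_{q^t} be a scattered q-polynomial over 𝔽_{q^t}, let a, b ∈ 𝔽_{q^t} with b ≠ 0, and let {1, ω, …, ω^{r−1}} be an 𝔽_{q^t}-basis of 𝔽_{q^n}. Set U_{a,b} = {(f(x_0) − a x_0, b x_0 + Σ_{i=1}^{r−1} x_i ω^i) : x_0, …, x_{r−1} ∈ 𝔽_{q^t}} ⊆ 𝔽_{q^n}². Then there exists an 𝔽_{q^n}-linear automorphism g of 𝔽_{q^n}² such that g(U_{a,b}) = U_p = {(x, p(x)) : x ∈ 𝔽_{q^n}}, where p(x) = Tr_{q^n/q^t}(f(x) − a x). In particular, L_{U_{a,b}} is PGL(2,q^n)-equivalent to L_{U_p}. -/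
open scoped Pointwise

/-- The relative trace of an extension of finite fields commutes with the powers of the Frobenius
of a smaller finite field. -/
theorem FiniteField.trace_pow_card_pow (K M L : Type*) [Field K] [Field M] [Field L]
    [Algebra K L] [Algebra M L] [Fintype K] [Fintype L] (i : ℕ) (x : L) :
    Algebra.trace M L (x ^ Fintype.card K ^ i) =
      Algebra.trace M L x ^ Fintype.card K ^ i := by
  apply FaithfulSMul.algebraMap_injective M L
  have hfrob : ∀ z : L, (FiniteField.frobeniusAlgHom K L ^ i) z = z ^ Fintype.card K ^ i := by
    intro z
    rw [AlgHom.coe_pow, FiniteField.coe_frobeniusAlgHom, pow_iterate]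
  rw [map_pow (algebraMap M L), FiniteField.algebraMap_trace_eq_sum_pow,
    FiniteField.algebraMap_trace_eq_sum_pow, ← hfrob (∑ _ ∈ _, _), map_sum]
  simp_rw [hfrob, pow_right_comm]

/-- Every nonzero linear functional is of the form `y ↦ Tr (l * y)` with `l ≠ 0`. -/
theorem Algebra.exists_trace_mul_eq {M L : Type*} [Field M] [Field L] [Algebra M L]
    [FiniteDimensional M L] [Algebra.IsSeparable M L] (φ : L →ₗ[M] M) (hφ : φ ≠ 0) :
    ∃ l : L, l ≠ 0 ∧ ∀ y, Algebra.trace M L (l * y) = φ y := by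
  have h : ∀ y, Algebra.trace M L
      (((Algebra.traceForm M L).toDual (traceForm_nondegenerate M L)).symm φ * y) = φ y := by
    intro y
    rw [← Algebra.traceForm_apply, LinearMap.BilinForm.apply_toDual_symm_apply]
  refine ⟨_, ?_, h⟩
  simpa using hφ

/-- Theorem `th:polscattclub`: a polynomial description of the clubs of
Construction `constr:clubviascattered`. Here `K = 𝔽_q ⊆ M = 𝔽_{q^t} ⊆ L = 𝔽_{q^n}`. -/
theorem stmt_15 (q n t r : ℕ) (K M L : Type*) [Field K] [Field M] [Field L]
    [Algebra K M] [Algebra M L] [Algebra K L] [IsScalarTower K M L]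
    [Fintype K] [Fintype M] [Fintype L]
    (hq : Fintype.card K = q) (ht : Module.finrank K M = t)
    (hr : Module.finrank M L = r) (hn : n = r * t)
    (ht1 : 1 < t) (hr1 : 1 < r)
    -- the scattered q-polynomial f over 𝔽_{q^t}, and its extension fL to 𝔽_{q^n}
    (c : Fin t → M) (f : M → M) (fL : L → L)
    (hf : ∀ x, f x = ∑ i : Fin t, c i * x ^ q ^ (i : ℕ))
    (hfL : ∀ x, fL x = ∑ i : Fin t, algebraMap M L (c i) * x ^ q ^ (i : ℕ))
    (hsc : ∀ m x y : M, f x = m * x → f y = m * y → x ≠ 0 → ∃ μ : K, y = μ • x)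
    (a b : M) (hb : b ≠ 0)
    -- ω gives an 𝔽_{q^t}-basis 1, ω, …, ω^{r-1} of 𝔽_{q^n}
    (ω : L)
    (hωli : LinearIndependent M fun i : Fin r => ω ^ (i : ℕ))
    (hωsp : Submodule.span M (Set.range fun i : Fin r => ω ^ (i : ℕ)) = ⊤)
    (Uab : Set (L × L))
    (hUab : Uab = {p : L × L | ∃ (x₀ : M) (x : Fin (r - 1) → M),
        p = (algebraMap M L (f x₀ - a * x₀),
          algebraMap M L (b * x₀) +
            ∑ i : Fin (r - 1), algebraMap M L (x i) * ω ^ ((i : ℕ) + 1))}) :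
    ∃ g : (L × L) ≃ₗ[L] (L × L),
      g '' Uab = {p : L × L | ∃ x : L,
        p = (x, algebraMap M L
          (Algebra.trace M L (fL x - algebraMap M L a * x)))} := by
  subst hq
  obtain ⟨s, rfl⟩ : ∃ s, r = s + 1 := ⟨r - 1, by omega⟩
  set e : Module.Basis (Fin (s + 1)) M L := Module.Basis.mk hωli hωsp.ge with he
  have he_apply : ∀ i, e i = ω ^ (i : ℕ) := fun i => by rw [he, Module.Basis.mk_apply]
  have hsum : ∀ d : Fin (s + 1) → M, ∑ i, d i • e i =
      algebraMap M L (d 0) + ∑ i : Fin s, algebraMap M L (d i.succ) * ω ^ ((i : ℕ) + 1) := by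
    intro d
    simp [Fin.sum_univ_succ, he_apply, Algebra.smul_def]
  have hcoord : ∀ (d₀ : M) (d : Fin s → M), e.coord 0 (algebraMap M L d₀ +
      ∑ i : Fin s, algebraMap M L (d i) * ω ^ ((i : ℕ) + 1)) = d₀ := by
    intro d₀ d
    have h := hsum (Fin.cons d₀ d)
    simp only [Fin.cons_zero, Fin.cons_succ] at h
    rw [← h, Module.Basis.coord_apply, e.repr_sum_self, Fin.cons_zero]
  obtain ⟨l, hl, htr⟩ := Algebra.exists_trace_mul_eq (b⁻¹ • e.coord 0) (by
    intro h
    have h0 := LinearMap.congr_fun h (e 0)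
    simp [hb] at h0)
  have hp : ∀ x, Algebra.trace M L (fL x - algebraMap M L a * x) =
      f (Algebra.trace M L x) - a * Algebra.trace M L x := by
    intro x
    simp_rw [hf, hfL, map_sub, map_sum, ← Algebra.smul_def, map_smul,
      FiniteField.trace_pow_card_pow, smul_eq_mul]
  refine ⟨(LinearEquiv.prodComm L L L).trans
    ((LinearEquiv.smulOfNeZero L L l hl).prodCongr (LinearEquiv.refl L L)), ?_⟩
  subst hUab
  ext p
  constructor
  · rintro ⟨_, ⟨x₀, x, rfl⟩, rfl⟩
    refine ⟨l * (algebraMap M L (b * x₀) +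
      ∑ i : Fin s, algebraMap M L (x i) * ω ^ ((i : ℕ) + 1)), ?_⟩
    rw [hp, htr, LinearMap.smul_apply, hcoord, smul_eq_mul, inv_mul_cancel_left₀ hb]
    rfl
  · rintro ⟨x, rfl⟩
    refine ⟨_, ⟨Algebra.trace M L x, fun i => e.repr (l⁻¹ * x) i.succ, rfl⟩, ?_⟩
    have hx : b * Algebra.trace M L x = e.repr (l⁻¹ * x) 0 := by
      have h := htr (l⁻¹ * x)
      rw [mul_inv_cancel_left₀ hl, LinearMap.smul_apply, smul_eq_mul,
        Module.Basis.coord_apply] at h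
      rw [h, mul_inv_cancel_left₀ hb]
    have hrepr := hsum (e.repr (l⁻¹ * x))
    rw [e.sum_repr] at hrepr
    rw [hp, hx]
    refine Prod.ext ?_ rfl
    change l * (_ + _) = x
    exact (congrArg (l * ·) hrepr.symm).trans (mul_inv_cancel_left₀ hl x)
end
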